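/- Assume d ≥ 3 and that the periods q₁,…,q_d are pairwise coprime. Let V = ⊕_{j=1}^r V_j and Y = ⊕_{j=1}^r Y_j be complex-valued (d₁,…,d_r) separable Γ-periodic potentials that are Fermi isospectral. Then there exist constants c₁,…,c_r ∈ ℂ with c₁ + ⋯ + c_r = 0 such that for each j = 1,…,r the lower-dimensional potentials V_j and Y_j + c_j are Floquet isospectral (as periodic potentials on W_j, with Floquet isospectrality defined exactly as in dimension d but with d replaced by d_j and the periods replaced by the q_b with b in the j-th block). -/

import Mathlib

open scoped BigOperators

noncomputable section

namespace DPSO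

/-- The Floquet matrix `𝒟_V(z)` of the discrete periodic Schrödinger operator, indexed by the
fundamental domain `W = ∏ i, ZMod (q i)`. -/
def floquetMat {d : ℕ} (q : Fin d → ℕ) [∀ i, NeZero (q i)]
    (V : (∀ i, ZMod (q i)) → ℂ) (z : Fin d → ℂ) :
    Matrix (∀ i, ZMod (q i)) (∀ i, ZMod (q i)) ℂ :=
  fun n n' =>
    (∑ j : Fin d,
      ((if n' = n + Pi.single j 1 then (if (n j).val = q j - 1 then z j else 1) else 0)
        + (if n' = n - Pi.single j 1 then (if (n j).val = 0 then (z j)⁻¹ else 1) else 0)))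
    + (if n' = n then V n else 0)

/-- Two `Γ`-periodic potentials are Floquet isospectral if for every real quasimomentum `k`
the Floquet matrices have the same characteristic polynomial. -/
def FloquetIso {d : ℕ} (q : Fin d → ℕ) [∀ i, NeZero (q i)]
    (V Y : (∀ i, ZMod (q i)) → ℂ) : Prop :=
  ∀ k : Fin d → ℝ,
    (floquetMat q V (fun j => Complex.exp (2 * Real.pi * Complex.I * (k j)))).charpoly
      = (floquetMat q Y (fun j => Complex.exp (2 * Real.pi * Complex.I * (k j)))).charpoly

/-- Two `Γ`-periodic potentials are Fermi isospectral if for some `λ₀` their Fermi surfaces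
(inside `(ℂ∖{0})^d`) coincide. -/
def FermiIso {d : ℕ} (q : Fin d → ℕ) [∀ i, NeZero (q i)]
    (V Y : (∀ i, ZMod (q i)) → ℂ) : Prop :=
  ∃ lam : ℂ,
    {z : Fin d → ℂ | (∀ j, z j ≠ 0) ∧ (floquetMat q V z - lam • 1).det = 0}
      = {z : Fin d → ℂ | (∀ j, z j ≠ 0) ∧ (floquetMat q Y z - lam • 1).det = 0}

/-- The offset (start index) of the `j`-th consecutive block of sizes `ds 0, …, ds (r-1)`. -/
def blockOffset {r : ℕ} (ds : Fin r → ℕ) (j : Fin r) : ℕ :=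
  ∑ m ∈ Finset.univ.filter (fun m => m < j), ds m

lemma blockOffset_add_le {r : ℕ} (ds : Fin r → ℕ) (j : Fin r) :
    blockOffset ds j + ds j ≤ ∑ m, ds m := by
  have hj : j ∉ Finset.univ.filter (fun m : Fin r => m < j) := by simp
  have h : blockOffset ds j + ds j
      = ∑ m ∈ insert j (Finset.univ.filter (fun m : Fin r => m < j)), ds m := by
    rw [Finset.sum_insert hj, Nat.add_comm, blockOffset]
  rw [h]
  exact Finset.sum_le_sum_of_subset (Finset.subset_univ _)

/-- The embedding of the index set of the `j`-th block into `Fin d`. -/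
def blockEmb {d r : ℕ} (ds : Fin r → ℕ) (hsum : ∑ m, ds m = d) (j : Fin r)
    (b : Fin (ds j)) : Fin d :=
  ⟨blockOffset ds j + b.val, by
    have h1 := blockOffset_add_le ds j
    have h2 := b.isLt
    omega⟩

/-- `V` is `(d₁,…,d_r)` separable: it is a sum of functions, the `j`-th of which depends only
on the coordinates in the `j`-th block. -/
def IsSeparable {d r : ℕ} (q : Fin d → ℕ) (ds : Fin r → ℕ) (hsum : ∑ m, ds m = d)
    (V : (∀ i, ZMod (q i)) → ℂ) : Prop :=
  ∃ F : ∀ j : Fin r, ((∀ b : Fin (ds j), ZMod (q (blockEmb ds hsum j b))) → ℂ),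
    ∀ n, V n = ∑ j, F j (fun b => n (blockEmb ds hsum j b))

/-- The discrete Fourier transform of `V`. -/
def dft {d : ℕ} (q : Fin d → ℕ) [∀ i, NeZero (q i)] (V : (∀ i, ZMod (q i)) → ℂ)
    (l : ∀ i, ZMod (q i)) : ℂ :=
  (1 / ∏ i, (q i : ℂ)) * ∑ n : ∀ i, ZMod (q i), V n *
    Complex.exp (-(2 * Real.pi * Complex.I) *
      ∑ j, ((l j).val : ℂ) * ((n j).val : ℂ) / (q j : ℂ))

/-- `ρ^j_m = e^{2πi m/q_j}`. -/
def rho {d : ℕ} (q : Fin d → ℕ) (j : Fin d) (m : ℕ) : ℂ :=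
  Complex.exp (2 * Real.pi * Complex.I * (m : ℂ) / (q j : ℂ))

/-- The average `[V]` of a potential. -/
def avg {d : ℕ} (q : Fin d → ℕ) [∀ i, NeZero (q i)] (V : (∀ i, ZMod (q i)) → ℂ) : ℂ :=
  (1 / ∏ i, (q i : ℂ)) * ∑ n, V n

/-- The diagonal matrix `A(z)`. -/
def diagA {d : ℕ} (q : Fin d → ℕ) [∀ i, NeZero (q i)] (z : Fin d → ℂ) :
    Matrix (∀ i, ZMod (q i)) (∀ i, ZMod (q i)) ℂ :=
  Matrix.diagonal (fun n => ∑ j, (rho q j ((n j).val) * z j + (rho q j ((n j).val) * z j)⁻¹))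

/-- The matrix `B_V` with entries `V̂(n - n')`. -/
def matB {d : ℕ} (q : Fin d → ℕ) [∀ i, NeZero (q i)] (V : (∀ i, ZMod (q i)) → ℂ) :
    Matrix (∀ i, ZMod (q i)) (∀ i, ZMod (q i)) ℂ :=
  fun n n' => dft q V (n - n')

section Auxiliary

open Filter Topology Polynomial

/-- If roots of `P p` get arbitrarily close to `σ`, they can be selected to converge to `σ`. -/
lemma exists_tendsto_root {α : Type*} {l : Filter α} {P : α → ℂ[X]} {σ : ℂ}
    (h : ∀ ε > 0, ∀ᶠ p in l, ∃ r, (P p).eval r = 0 ∧ dist r σ < ε) (hP : ∀ p, P p ≠ 0) :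
    ∃ r : α → ℂ, (∀ᶠ p in l, (P p).eval (r p) = 0) ∧ Tendsto r l (𝓝 σ) := by
  have key : ∀ p, ∃ r, (∃ x, (P p).eval x = 0) →
      (P p).eval r = 0 ∧ ∀ x, (P p).eval x = 0 → dist r σ ≤ dist x σ := by
    intro p
    by_cases hx : ∃ x, (P p).eval x = 0
    · obtain ⟨x, hx⟩ := hx
      obtain ⟨r, hr, hmin⟩ := (P p).roots.toFinset.exists_min_image (fun y => dist y σ)
        ⟨x, by simpa [hP p] using hx⟩
      refine ⟨r, fun _ => ⟨by simpa [hP p] using hr, fun y hy => hmin y ?_⟩⟩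
      simpa [hP p] using hy
    · exact ⟨0, fun h => absurd h hx⟩
  choose r hr using key
  refine ⟨r, ?_, ?_⟩
  · filter_upwards [h 1 one_pos] with p ⟨x, hx, _⟩
    exact (hr p ⟨x, hx⟩).1
  · rw [Metric.tendsto_nhds]
    intro ε hε
    filter_upwards [h ε hε] with p ⟨x, hx, hd⟩
    exact ((hr p ⟨x, hx⟩).2 x hx).trans_lt hd

lemma norm_prod_map {α : Type*} (s : Multiset α) (f : α → ℂ) :
    ‖(s.map f).prod‖ = (s.map fun a => ‖f a‖).prod := by
  simpa using (Multiset.prod_hom (s.map f) (normHom (α := ℂ))).symm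

lemma exists_root_dist_lt_of_monic {P : ℂ[X]} (hP : P.Monic) {σ : ℂ} {δ : ℝ} (hδ : 0 < δ)
    (h : ‖P.eval σ‖ < δ ^ P.natDegree) : ∃ r, P.eval r = 0 ∧ dist r σ < δ := by
  by_contra! hc
  have hs := IsAlgClosed.splits P
  have hprod : P.eval σ = (P.roots.map (fun r => σ - r)).prod := by
    simpa [hP.leadingCoeff] using hs.eval_eq_prod_roots σ
  have : δ ^ P.natDegree ≤ ‖P.eval σ‖ := by
    rw [hprod, hs.natDegree_eq_card_roots, ← Multiset.prod_replicate,
      ← Multiset.map_const', norm_prod_map]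
    refine Multiset.prod_map_le_prod_map₀ _ _ (fun _ _ => hδ.le) fun r hr => ?_
    have := hc r (by simpa using (mem_roots'.1 hr).2)
    simpa [dist_comm, dist_eq_norm] using this
  linarith

lemma exists_root_dist_lt_of_eval_zero {P : ℂ[X]} {N : ℕ} (hN : P.natDegree ≤ N)
    {σ : ℂ} {δ : ℝ} (hδ : 0 < δ) (hδ1 : δ ≤ 1)
    (h : ‖P.eval σ‖ < δ ^ N * ‖P.eval 0‖) : ∃ r, P.eval r = 0 ∧ dist r σ < δ * ‖r‖ := by
  by_contra! hc
  have hs := IsAlgClosed.splits P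
  have hprod (σ : ℂ) : ‖P.eval σ‖ = ‖P.leadingCoeff‖ * (P.roots.map (fun r => ‖σ - r‖)).prod := by
    rw [hs.eval_eq_prod_roots σ, norm_mul, norm_prod_map]
  have : δ ^ N * ‖P.eval 0‖ ≤ ‖P.eval σ‖ := by
    refine (mul_le_mul_of_nonneg_right (pow_le_pow_of_le_one hδ.le hδ1 hN)
      (norm_nonneg _)).trans ?_
    rw [hprod, hprod, hs.natDegree_eq_card_roots, mul_left_comm]
    refine mul_le_mul_of_nonneg_left ?_ (norm_nonneg _)
    rw [← Multiset.prod_replicate, ← Multiset.map_const', ← Multiset.prod_map_mul]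
    refine Multiset.prod_map_le_prod_map₀ _ _ (fun r _ => by positivity) fun r hr => ?_
    have := hc r (by simpa using (mem_roots'.1 hr).2)
    simpa [dist_comm, dist_eq_norm, norm_sub_rev] using this
  linarith

/-- Selection of convergent roots for polynomials of bounded degree with fixed constant term. -/
lemma exists_tendsto_root_of_eval_zero {α : Type*} {l : Filter α} {P : α → ℂ[X]} {N : ℕ}
    {c σ : ℂ} (hc : c ≠ 0) (hN : ∀ p, (P p).natDegree ≤ N) (h0 : ∀ p, (P p).eval 0 = c)
    (hσ : Tendsto (fun p => (P p).eval σ) l (𝓝 0)) :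
    ∃ r : α → ℂ, (∀ᶠ p in l, (P p).eval (r p) = 0) ∧ Tendsto r l (𝓝 σ) := by
  refine exists_tendsto_root (fun ε hε => ?_) fun p hp => hc (by rw [← h0 p, hp, eval_zero])
  set δ : ℝ := min (1 / 2) (ε / (2 * (‖σ‖ + 1))) with hδ
  have hδ0 : 0 < δ := by positivity
  have hδ2 : δ ≤ 1 / 2 := min_le_left _ _
  have hδε : δ * (2 * (‖σ‖ + 1)) ≤ ε := by
    rw [← le_div_iff₀ (by positivity)]; exact min_le_right _ _
  have hpos : 0 < δ ^ N * ‖c‖ := by positivity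
  filter_upwards [(Metric.tendsto_nhds.1 hσ) _ hpos] with p hp
  obtain ⟨r, hr, hd⟩ := exists_root_dist_lt_of_eval_zero (σ := σ) (hN p) hδ0 (by linarith)
    (by rw [h0]; simpa [dist_eq_norm] using hp)
  refine ⟨r, hr, ?_⟩
  have h1 : ‖r‖ ≤ ‖σ‖ + dist r σ := by
    rw [dist_eq_norm]
    calc ‖r‖ = ‖σ + (r - σ)‖ := by ring_nf
      _ ≤ _ := norm_add_le _ _
  have h2 : dist r σ < δ * (‖σ‖ + dist r σ) := hd.trans_le (by gcongr)
  have h3 := dist_nonneg (x := r) (y := σ)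
  nlinarith [norm_nonneg σ]

/-- Monic polynomials whose values at distinct points tend to zero factor into linear factors
with roots tending to these points. -/
lemma exists_tendsto_prod_X_sub_C {α M : Type*} [Fintype M] {l : Filter α} {P : α → ℂ[X]}
    {x : M → ℂ} (hx : Function.Injective x) (hP : ∀ p, (P p).Monic)
    (hdeg : ∀ p, (P p).natDegree = Fintype.card M)
    (h0 : ∀ m, Tendsto (fun p => (P p).eval (x m)) l (𝓝 0)) :
    ∃ ξ : α → M → ℂ, (∀ᶠ p in l, P p = ∏ m, (X - C (ξ p m))) ∧
      ∀ m, Tendsto (fun p => ξ p m) l (𝓝 (x m)) := by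
  have key : ∀ m, ∃ r : α → ℂ, (∀ᶠ p in l, (P p).eval (r p) = 0) ∧ Tendsto r l (𝓝 (x m)) := by
    intro m
    refine exists_tendsto_root (fun ε hε => ?_) fun p => (hP p).ne_zero
    have hpos : 0 < ε ^ Fintype.card M := by positivity
    filter_upwards [(Metric.tendsto_nhds.1 (h0 m)) _ hpos] with p hp
    exact exists_root_dist_lt_of_monic (hP p) hε (by rw [hdeg]; simpa [dist_eq_norm] using hp)
  choose r hr hlim using key
  refine ⟨fun p m => r m p, ?_, hlim⟩
  have hinj : ∀ᶠ p in l, ∀ m m', m ≠ m' → r m p ≠ r m' p := by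
    simp only [eventually_all]
    intro m m' hne
    have := ((hlim m).prodMk_nhds (hlim m')).eventually
      ((isOpen_ne_fun continuous_fst continuous_snd).mem_nhds (hx.ne hne))
    exact this
  have hroot : ∀ᶠ p in l, ∀ m, (P p).eval (r m p) = 0 := eventually_all.2 hr
  filter_upwards [hinj, hroot] with p hp hz
  refine eq_of_monic_of_dvd_of_natDegree_le (monic_prod_X_sub_C _ _) (hP p) ?_ ?_
  · refine Finset.prod_dvd_of_coprime (fun m _ m' _ hne => ?_) fun m _ => ?_
    · exact isCoprime_X_sub_C_of_isUnit_sub (sub_ne_zero.2 (hp m m' hne)).isUnit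
    · exact dvd_iff_isRoot.2 (hz m)
  · rw [hdeg, natDegree_finsetProd_X_sub_C_eq_card, Finset.card_univ]

lemma exists_forall_sum_mul_ne_zero {ι κ : Type*} [Fintype ι] [DecidableEq ι] [Finite κ]
    (v : κ → ι → ℂ) (hv : ∀ k, v k ≠ 0) : ∃ a : ι → ℂ, ∀ k, ∑ i, v k i * a i ≠ 0 := by
  obtain ⟨f, hf⟩ := Module.exists_dual_forall_apply_ne_zero (K := ℂ) v hv
  refine ⟨fun i => f (Pi.single i 1), fun k => ?_⟩
  rw [show ∑ i, v k i * f (Pi.single i 1) = f (v k) by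
    conv_rhs => rw [pi_eq_sum_univ' (v k)]
    simp [map_sum]
    ]
  exact hf k

lemma mvPolynomial_eq_zero_of_eventually {ι : Type*} [Finite ι] {P : MvPolynomial ι ℂ}
    {a : ι → ℂ} (h : ∀ᶠ x in 𝓝 a, MvPolynomial.eval x P = 0) : P = 0 := by
  cases nonempty_fintype ι
  obtain ⟨ε, hε, hP⟩ := Metric.eventually_nhds_iff_ball.1 h
  refine MvPolynomial.funext_set (fun i => Metric.ball (a i) ε) (fun i => ?_) fun x hx => ?_
  · exact infinite_of_mem_nhds (a i) (Metric.ball_mem_nhds _ hε)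
  · rw [hP x (by simpa [ball_pi _ hε] using hx), map_zero]

lemma natDegree_det_le {N : Type*} [Fintype N] [DecidableEq N] {M : Matrix N N ℂ[X]} {k : ℕ}
    (h : ∀ i j, (M i j).natDegree ≤ k) :
    M.det.natDegree ≤ k * Fintype.card N := by
  rw [Matrix.det_apply]
  refine natDegree_sum_le_of_forall_le _ _ fun g _ => ?_
  calc (Equiv.Perm.sign g • ∏ i, M (g i) i).natDegree
      ≤ (∏ i, M (g i) i).natDegree := natDegree_smul_le _ _
    _ ≤ ∑ i, (M (g i) i).natDegree := natDegree_prod_le _ _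
    _ ≤ ∑ _i : N, k := Finset.sum_le_sum fun i _ => h _ _
    _ = k * Fintype.card N := by simp [mul_comm]

section Bloch

variable {ι N : Type*} [Fintype ι] [Fintype N] [DecidableEq N]

/-- The eigenvalues of the free Floquet matrix, for an abstract system `ρ` of phases. -/
def blochSymbol (ρ : N → ι → ℂ) (w : ι → ℂ) (n : N) : ℂ :=
  ∑ i, (ρ n i * w i + (ρ n i * w i)⁻¹)

/-- The characteristic polynomial of `B` perturbed by the diagonal free part, evaluated at `x`. -/
def blochDet (ρ : N → ι → ℂ) (B : Matrix N N ℂ) (w : ι → ℂ) (x : ℂ) : ℂ :=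
  (Matrix.diagonal (blochSymbol ρ w) + B).charpoly.eval x

lemma blochDet_eq_det (ρ : N → ι → ℂ) (B : Matrix N N ℂ) (w : ι → ℂ) (x : ℂ) :
    blochDet ρ B w x = (Matrix.diagonal (fun n => x - blochSymbol ρ w n) - B).det := by
  rw [blochDet, Matrix.eval_charpoly]
  congr 1
  ext n n'
  by_cases h : n = n'
  · simp [h]
    ring
  · simp [h, Matrix.diagonal]

/-- The matrix of `blochDet`, multiplied by `τ`, at the point `a / τ`. -/
def scaledMatrix (ρ : N → ι → ℂ) (B : Matrix N N ℂ) (τ : ℂ) (a : ι → ℂ) : Matrix N N ℂ :=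
  Matrix.diagonal (fun n => ∑ i, (ρ n i * a i + τ ^ 2 * (ρ n i * a i)⁻¹)) + τ • B

lemma eval_charpoly_scaledMatrix (ρ : N → ι → ℂ) (B : Matrix N N ℂ) {τ : ℂ} (hτ : τ ≠ 0)
    (a : ι → ℂ) (x : ℂ) :
    (scaledMatrix ρ B τ a).charpoly.eval (τ * x)
      = τ ^ Fintype.card N * blochDet ρ B (τ⁻¹ • a) x := by
  rw [blochDet_eq_det, Matrix.eval_charpoly, ← Matrix.det_smul]
  congr 1
  have h (n : N) : ∑ i, (ρ n i * a i + τ ^ 2 * (ρ n i * a i)⁻¹)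
      = τ * blochSymbol ρ (τ⁻¹ • a) n := by
    rw [blochSymbol, Finset.mul_sum]
    refine Finset.sum_congr rfl fun i _ => ?_
    simp only [Pi.smul_apply, smul_eq_mul, mul_inv, inv_inv]
    field_simp
  ext n n'
  by_cases hn : n = n'
  · subst hn
    simp only [scaledMatrix, h, Matrix.sub_apply, Matrix.add_apply, Matrix.smul_apply,
      Matrix.diagonal_apply_eq, Matrix.scalar_apply, smul_eq_mul]
    ring
  · simp [scaledMatrix, hn, Matrix.diagonal]

lemma continuousAt_charpoly_scaledMatrix {ρ : N → ι → ℂ} (hρ : ∀ n i, ρ n i ≠ 0)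
    (B : Matrix N N ℂ) {a₀ : ι → ℂ} (ha : ∀ i, a₀ i ≠ 0) (x : ℂ) :
    ContinuousAt (fun p : ℂ × (ι → ℂ) => (scaledMatrix ρ B p.1 p.2).charpoly.eval x) (0, a₀) := by
  simp only [Matrix.eval_charpoly]
  refine ContinuousAt.comp (g := Matrix.det)
    (f := fun p : ℂ × (ι → ℂ) => Matrix.scalar N x - scaledMatrix ρ B p.1 p.2)
    (Continuous.matrix_det continuous_id).continuousAt ?_
  refine continuousAt_const.sub (ContinuousAt.add ?_ (by fun_prop))
  refine ContinuousAt.comp (g := Matrix.diagonal) (f := fun (p : ℂ × (ι → ℂ)) (n : N) =>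
    ∑ i, (ρ n i * p.2 i + p.1 ^ 2 * (ρ n i * p.2 i)⁻¹))
    (Continuous.matrix_diagonal continuous_id).continuousAt ?_
  refine continuousAt_pi.2 fun n => tendsto_finsetSum _ fun i _ => ?_
  have : ContinuousAt (fun p : ℂ × (ι → ℂ) => (ρ n i * p.2 i)⁻¹) (0, a₀) :=
    ContinuousAt.inv₀ (by fun_prop) (mul_ne_zero (hρ n i) (ha i))
  exact ContinuousAt.add (by fun_prop) (ContinuousAt.mul (by fun_prop) this)

lemma charpoly_scaledMatrix_zero (ρ : N → ι → ℂ) (B : Matrix N N ℂ) (a : ι → ℂ) (x : ℂ) :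
    (scaledMatrix ρ B 0 a).charpoly.eval x = ∏ n, (x - ∑ i, ρ n i * a i) := by
  rw [Matrix.eval_charpoly, ← Matrix.det_diagonal]
  congr 1
  ext n n'
  by_cases h : n = n' <;> simp [h, scaledMatrix, Matrix.diagonal]

variable [DecidableEq ι]

/-- The matrix whose determinant describes `blochDet` as a function of the coordinate `i₀`,
in the variable `σ = (τ w)⁻¹`. -/
def pencil (ρ : N → ι → ℂ) (i₀ : ι) (B : Matrix N N ℂ) (τ : ℂ) (a : ι → ℂ) (y σ : ℂ) :
    Matrix N N ℂ :=
  Matrix.diagonal (fun n => σ * y - (ρ n i₀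
    + σ * ∑ i ∈ Finset.univ.erase i₀, (ρ n i * a i + τ ^ 2 * (ρ n i * a i)⁻¹)
    + σ ^ 2 * (τ ^ 2 * (ρ n i₀)⁻¹))) - (σ * τ) • B

lemma det_pencil (ρ : N → ι → ℂ) (i₀ : ι) (B : Matrix N N ℂ) {τ σ : ℂ} (hτ : τ ≠ 0)
    (hσ : σ ≠ 0) (a : ι → ℂ) (x : ℂ) :
    (pencil ρ i₀ B τ a (τ * x) σ).det = (σ * τ) ^ Fintype.card N *
      blochDet ρ B (Function.update (τ⁻¹ • a) i₀ (σ * τ)⁻¹) x := by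
  rw [blochDet_eq_det, ← Matrix.det_smul]
  congr 1
  have h (n : N) : σ * τ * blochSymbol ρ (Function.update (τ⁻¹ • a) i₀ (σ * τ)⁻¹) n
      = ρ n i₀ + σ * ∑ i ∈ Finset.univ.erase i₀, (ρ n i * a i + τ ^ 2 * (ρ n i * a i)⁻¹)
        + σ ^ 2 * (τ ^ 2 * (ρ n i₀)⁻¹) := by
    rw [blochSymbol, ← Finset.add_sum_erase _ _ (Finset.mem_univ i₀), mul_add]
    have h1 : σ * τ * (ρ n i₀ * (Function.update (τ⁻¹ • a) i₀ (σ * τ)⁻¹) i₀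
        + (ρ n i₀ * (Function.update (τ⁻¹ • a) i₀ (σ * τ)⁻¹) i₀)⁻¹)
        = ρ n i₀ + σ ^ 2 * (τ ^ 2 * (ρ n i₀)⁻¹) := by
      simp only [Function.update_self, mul_inv, inv_inv]
      field_simp
    have h2 : σ * τ * ∑ i ∈ Finset.univ.erase i₀,
        (ρ n i * (Function.update (τ⁻¹ • a) i₀ (σ * τ)⁻¹) i
          + (ρ n i * (Function.update (τ⁻¹ • a) i₀ (σ * τ)⁻¹) i)⁻¹)
        = σ * ∑ i ∈ Finset.univ.erase i₀, (ρ n i * a i + τ ^ 2 * (ρ n i * a i)⁻¹) := by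
      rw [mul_assoc]
      congr 1
      rw [Finset.mul_sum]
      refine Finset.sum_congr rfl fun i hi => ?_
      rw [Function.update_of_ne (Finset.ne_of_mem_erase hi)]
      simp only [Pi.smul_apply, smul_eq_mul, mul_inv, inv_inv]
      field_simp
    rw [h1, h2]
    ring
  ext n n'
  by_cases hn : n = n'
  · subst hn
    simp only [pencil, ← h, Matrix.sub_apply, Matrix.diagonal_apply_eq, Matrix.smul_apply,
      smul_eq_mul]
    ring
  · simp [pencil, hn, Matrix.diagonal]

lemma continuousAt_det_pencil {ρ : N → ι → ℂ} (hρ : ∀ n i, ρ n i ≠ 0) (i₀ : ι)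
    (B : Matrix N N ℂ) {a₀ : ι → ℂ} (ha : ∀ i, a₀ i ≠ 0) (y₀ σ₀ : ℂ) :
    ContinuousAt (fun p : (ℂ × (ι → ℂ)) × ℂ × ℂ =>
      (pencil ρ i₀ B p.1.1 p.1.2 p.2.1 p.2.2).det) ((0, a₀), y₀, σ₀) := by
  refine ContinuousAt.comp (g := Matrix.det)
    (f := fun p : (ℂ × (ι → ℂ)) × ℂ × ℂ => pencil ρ i₀ B p.1.1 p.1.2 p.2.1 p.2.2)
    (Continuous.matrix_det continuous_id).continuousAt ?_
  refine ContinuousAt.sub ?_ (by fun_prop)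
  refine ContinuousAt.comp (g := Matrix.diagonal)
    (f := fun (p : (ℂ × (ι → ℂ)) × ℂ × ℂ) (n : N) => p.2.2 * p.2.1 - (ρ n i₀
    + p.2.2 * ∑ i ∈ Finset.univ.erase i₀, (ρ n i * p.1.2 i + p.1.1 ^ 2 * (ρ n i * p.1.2 i)⁻¹)
    + p.2.2 ^ 2 * (p.1.1 ^ 2 * (ρ n i₀)⁻¹)))
    (Continuous.matrix_diagonal continuous_id).continuousAt ?_
  refine continuousAt_pi.2 fun n => ContinuousAt.sub (by fun_prop)
    (ContinuousAt.add (ContinuousAt.add (by fun_prop) (ContinuousAt.mul (by fun_prop) ?_))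
      (by fun_prop))
  refine tendsto_finsetSum _ fun i _ => ?_
  have : ContinuousAt (fun p : (ℂ × (ι → ℂ)) × ℂ × ℂ => (ρ n i * p.1.2 i)⁻¹)
      ((0, a₀), y₀, σ₀) :=
    ContinuousAt.inv₀ (by fun_prop) (mul_ne_zero (hρ n i) (ha i))
  exact ContinuousAt.add (by fun_prop) (ContinuousAt.mul (by fun_prop) this)

lemma det_pencil_zero (ρ : N → ι → ℂ) (i₀ : ι) (B : Matrix N N ℂ) (a : ι → ℂ) (y σ : ℂ) :
    (pencil ρ i₀ B 0 a y σ).det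
      = ∏ n, (σ * y - (ρ n i₀ + σ * ∑ i ∈ Finset.univ.erase i₀, ρ n i * a i)) := by
  rw [← Matrix.det_diagonal]
  congr 1
  ext n n'
  by_cases h : n = n' <;> simp [h, pencil, Matrix.diagonal]

/-- The determinant of the pencil as a polynomial in `σ`. -/
lemma exists_polynomial_det_pencil (ρ : N → ι → ℂ) (i₀ : ι) (B : Matrix N N ℂ) (τ : ℂ)
    (a : ι → ℂ) (y : ℂ) : ∃ P : ℂ[X], P.natDegree ≤ 2 * Fintype.card N ∧
      ∀ σ, P.eval σ = (pencil ρ i₀ B τ a y σ).det := by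
  obtain ⟨R, hR⟩ : ∃ R : N → ℂ, ∀ n,
      ∑ i ∈ Finset.univ.erase i₀, (ρ n i * a i + τ ^ 2 * (ρ n i * a i)⁻¹) = R n :=
    ⟨_, fun _ => rfl⟩
  let M : Matrix N N ℂ[X] := Matrix.of fun n n' =>
    (if n = n' then X * C y - (C (ρ n i₀) + X * C (R n)
      + X ^ 2 * C (τ ^ 2 * (ρ n i₀)⁻¹)) else 0) - X * C (τ * B n n')
  refine ⟨M.det, natDegree_det_le fun n n' => ?_, fun σ => ?_⟩
  · simp only [M, Matrix.of_apply]
    split_ifs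
    · compute_degree
    · compute_degree
      norm_num
  · rw [← coe_evalRingHom, RingHom.map_det]
    congr 1
    ext n n'
    simp only [pencil, hR]
    by_cases h : n = n' <;> simp [M, h, Matrix.diagonal] <;> ring

lemma blochDet_update_inv {ρ : N → ι → ℂ} {i₀ : ι} {φ : Equiv.Perm N}
    (hφ₀ : ∀ n, ρ (φ n) i₀ = (ρ n i₀)⁻¹) (hφ : ∀ n, ∀ i ≠ i₀, ρ (φ n) i = ρ n i)
    (B : Matrix N N ℂ) (u : ι → ℂ) (w x : ℂ) :
    blochDet ρ B (Function.update u i₀ w⁻¹) x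
      = blochDet ρ (B.submatrix φ φ) (Function.update u i₀ w) x := by
  have hs (n : N) : blochSymbol ρ (Function.update u i₀ w⁻¹) (φ n)
      = blochSymbol ρ (Function.update u i₀ w) n := by
    refine Finset.sum_congr rfl fun i _ => ?_
    by_cases hi : i = i₀
    · subst hi
      simp only [hφ₀, Function.update_self, mul_inv, inv_inv]
      ring
    · simp [hφ n i hi, Function.update_of_ne hi]
  rw [blochDet, blochDet, ← Matrix.charpoly_reindex φ.symm]
  congr 2
  ext n n'
  simp [Matrix.diagonal_apply, hs]

end Bloch

section Matching

variable {ι₁ ι₂ N₁ N₂ α : Type*} [Fintype ι₁] [DecidableEq ι₁] [Fintype ι₂]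
  [Fintype N₁] [DecidableEq N₁] [Fintype N₂] [DecidableEq N₂]

/-- Near a zero of the limit pencil, the zeros of the first pencil are zeros of the second pencil
belonging to the same eigenvalue branch of the complementary block. -/
lemma exists_tendsto_common_root {ρ₁ : N₁ → ι₁ → ℂ} {ρ₂ : N₂ → ι₂ → ℂ}
    (hρ₁ : ∀ n i, ρ₁ n i ≠ 0) (i₀ : ι₁) {B₁ B₁' : Matrix N₁ N₁ ℂ} {B₂ B₂' : Matrix N₂ N₂ ℂ}
    {lam : ℂ}
    (hF : ∀ u v, (∀ i, u i ≠ 0) → (∀ i, v i ≠ 0) → ∀ x, blochDet ρ₁ B₁ u (lam - x) = 0 →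
      blochDet ρ₂ B₂ v x = 0 → ∃ y, blochDet ρ₁ B₁' u (lam - y) = 0 ∧ blochDet ρ₂ B₂' v y = 0)
    {l : Filter α} {τ : α → ℂ} {a : α → ι₁ → ℂ} {b : α → ι₂ → ℂ} {ξ η : α → N₂ → ℂ}
    {a₀ : ι₁ → ℂ} {ℓ : N₂ → ℂ} (ha₀ : ∀ i, a₀ i ≠ 0)
    (hτ : Tendsto τ l (𝓝 0)) (ha : Tendsto a l (𝓝 a₀)) (hb : ∀ᶠ p in l, ∀ i, b p i ≠ 0)
    (hξ : ∀ m, Tendsto (fun p => ξ p m) l (𝓝 (ℓ m)))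
    (hη : ∀ m, Tendsto (fun p => η p m) l (𝓝 (ℓ m)))
    (hξ' : ∀ᶠ p in l, (scaledMatrix ρ₂ B₂ (τ p) (b p)).charpoly = ∏ m, (X - C (ξ p m)))
    (hη' : ∀ᶠ p in l, (scaledMatrix ρ₂ B₂' (τ p) (b p)).charpoly = ∏ m, (X - C (η p m)))
    {κ : N₁ → N₂ → ℂ} (hκ : ∀ n m, κ n m = ∑ i ∈ Finset.univ.erase i₀, ρ₁ n i * a₀ i + ℓ m)
    (hκ0 : ∀ n m, κ n m ≠ 0)
    (hinj : ∀ n m n' m', κ n m * ρ₁ n' i₀ = κ n' m' * ρ₁ n i₀ → n = n' ∧ m = m')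
    (n : N₁) (m : N₂) :
    ∃ r : α → ℂ, Tendsto r l (𝓝 (-ρ₁ n i₀ / κ n m)) ∧ ∀ᶠ p in l, τ p ≠ 0 →
      (pencil ρ₁ i₀ B₁ (τ p) (a p) (τ p * (lam - ξ p m / τ p)) (r p)).det = 0 ∧
      (pencil ρ₁ i₀ B₁' (τ p) (a p) (τ p * (lam - η p m / τ p)) (r p)).det = 0 := by
  have hmul {t x : ℂ} (ht : t ≠ 0) : t * (lam - x / t) = t * lam - x := by field_simp
  have hlim (B : Matrix N₁ N₁ ℂ) {ζ : α → N₂ → ℂ} {m' : N₂} {s : α → ℂ} {s₀ : ℂ}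
      (hζ : Tendsto (fun p => ζ p m') l (𝓝 (ℓ m'))) (hs : Tendsto s l (𝓝 s₀)) :
      Tendsto (fun p => (pencil ρ₁ i₀ B (τ p) (a p) (τ p * lam - ζ p m') (s p)).det) l
        (𝓝 (∏ n', -(ρ₁ n' i₀ + s₀ * κ n' m'))) := by
    have h1 := (continuousAt_det_pencil hρ₁ i₀ B ha₀ (0 * lam - ℓ m') s₀).tendsto.comp
      ((hτ.prodMk_nhds ha).prodMk_nhds (((hτ.mul_const lam).sub hζ).prodMk_nhds hs))
    rw [det_pencil_zero] at h1
    have e : ∏ n', -(ρ₁ n' i₀ + s₀ * κ n' m') = ∏ n', (s₀ * (0 * lam - ℓ m')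
        - (ρ₁ n' i₀ + s₀ * ∑ i ∈ Finset.univ.erase i₀, ρ₁ n' i * a₀ i)) :=
      Finset.prod_congr rfl fun n' _ => by rw [hκ]; ring
    rw [e]
    exact h1
  choose P hPdeg hP using fun p => exists_polynomial_det_pencil ρ₁ i₀ B₁ (τ p) (a p)
    (τ p * lam - ξ p m)
  obtain ⟨r, hr, hrlim⟩ := exists_tendsto_root_of_eval_zero (l := l) (P := P)
    (c := ∏ n', -ρ₁ n' i₀) (σ := -ρ₁ n i₀ / κ n m)
    (Finset.prod_ne_zero_iff.2 fun n' _ => neg_ne_zero.2 (hρ₁ n' i₀)) hPdeg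
    (fun p => by
      rw [hP, ← Matrix.det_diagonal]
      congr 1
      ext i j
      simp [pencil]) (by
      simp only [hP]
      convert hlim B₁ (hξ m) tendsto_const_nhds using 2
      refine (Finset.prod_eq_zero (Finset.mem_univ n) ?_).symm
      field_simp [hκ0 n m]
      ring)
  refine ⟨r, hrlim, ?_⟩
  have hσ0 : -ρ₁ n i₀ / κ n m ≠ 0 := div_ne_zero (neg_ne_zero.2 (hρ₁ n i₀)) (hκ0 n m)
  have hne : ∀ᶠ p in l, ∀ m', m' ≠ m →
      (pencil ρ₁ i₀ B₁' (τ p) (a p) (τ p * lam - η p m') (r p)).det ≠ 0 := by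
    simp only [eventually_all]
    intro m' hm'
    refine (hlim B₁' (hη m') hrlim).eventually_ne ?_
    refine Finset.prod_ne_zero_iff.2 fun n' _ => neg_ne_zero.2 fun h => hm' ?_
    refine (hinj n m n' m' ?_).2.symm
    have h2 := hκ0 n m
    field_simp at h
    linear_combination h
  have ha' : ∀ᶠ p in l, ∀ i, a p i ≠ 0 :=
    eventually_all.2 fun i => ((tendsto_pi_nhds.1 ha) i).eventually_ne (ha₀ i)
  filter_upwards [hr, hrlim.eventually_ne hσ0, hne, hb, ha', hξ', hη'] with
    p hp hp0 hpne hbp hap hξp hηp hτp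
  have hz : (pencil ρ₁ i₀ B₁ (τ p) (a p) (τ p * (lam - ξ p m / τ p)) (r p)).det = 0 := by
    rw [hmul hτp, ← hP, hp]
  refine ⟨hz, ?_⟩
  have hrτ : (r p * τ p) ^ Fintype.card N₁ ≠ 0 := pow_ne_zero _ (mul_ne_zero hp0 hτp)
  have hτN : τ p ^ Fintype.card N₂ ≠ 0 := pow_ne_zero _ hτp
  have hz1 := hz
  rw [det_pencil _ _ _ hτp hp0, mul_eq_zero, or_iff_right hrτ] at hz1
  obtain ⟨y, hy1, hy2⟩ := hF (Function.update ((τ p)⁻¹ • a p) i₀ (r p * τ p)⁻¹) ((τ p)⁻¹ • b p)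
    (fun i => by
      by_cases hi : i = i₀
      · subst hi
        simp [hp0, hτp]
      · simp [Function.update_of_ne hi, hτp, hap i])
    (fun i => by simp [hτp, hbp i]) (ξ p m / τ p) hz1 (by
      have := eval_charpoly_scaledMatrix ρ₂ B₂ hτp (b p) (ξ p m / τ p)
      rw [mul_div_cancel₀ _ hτp, hξp, eval_prod, Finset.prod_eq_zero (Finset.mem_univ m)
        (by simp)] at this
      exact (mul_eq_zero.1 this.symm).resolve_left hτN)
  have hy3 := eval_charpoly_scaledMatrix ρ₂ B₂' hτp (b p) y
  rw [hy2, mul_zero, hηp, eval_prod, Finset.prod_eq_zero_iff] at hy3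
  obtain ⟨m', -, hm'⟩ := hy3
  have hm'' : τ p * y = η p m' := by
    simpa [sub_eq_zero] using hm'
  have hz2 : (pencil ρ₁ i₀ B₁' (τ p) (a p) (τ p * lam - η p m') (r p)).det = 0 := by
    rw [← hm'', ← mul_sub, det_pencil _ _ _ hτp hp0, hy1, mul_zero]
  have : m' = m := by
    by_contra h
    exact hpne m' h hz2
  rw [hmul hτp, ← this, hz2]

/-- Along matching eigenvalue branches of the complementary block, the two determinants of the
first block agree as functions of the coordinate `i₀`. -/
lemma eventually_blochDet_eq {ρ₁ : N₁ → ι₁ → ℂ} {ρ₂ : N₂ → ι₂ → ℂ}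
    (hρ₁ : ∀ n i, ρ₁ n i ≠ 0) {i₀ : ι₁} {φ : Equiv.Perm N₁}
    (hφ₀ : ∀ n, ρ₁ (φ n) i₀ = (ρ₁ n i₀)⁻¹) (hφ : ∀ n, ∀ i ≠ i₀, ρ₁ (φ n) i = ρ₁ n i)
    {B₁ B₁' : Matrix N₁ N₁ ℂ} {B₂ B₂' : Matrix N₂ N₂ ℂ} {lam : ℂ}
    (hF : ∀ u v, (∀ i, u i ≠ 0) → (∀ i, v i ≠ 0) → ∀ x, blochDet ρ₁ B₁ u (lam - x) = 0 →
      blochDet ρ₂ B₂ v x = 0 → ∃ y, blochDet ρ₁ B₁' u (lam - y) = 0 ∧ blochDet ρ₂ B₂' v y = 0)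
    {l : Filter α} {τ : α → ℂ} {a : α → ι₁ → ℂ} {b : α → ι₂ → ℂ} {ξ η : α → N₂ → ℂ}
    {a₀ : ι₁ → ℂ} {ℓ : N₂ → ℂ} (ha₀ : ∀ i, a₀ i ≠ 0)
    (hτ : Tendsto τ l (𝓝 0)) (ha : Tendsto a l (𝓝 a₀)) (hb : ∀ᶠ p in l, ∀ i, b p i ≠ 0)
    (hξ : ∀ m, Tendsto (fun p => ξ p m) l (𝓝 (ℓ m)))
    (hη : ∀ m, Tendsto (fun p => η p m) l (𝓝 (ℓ m)))
    (hξ' : ∀ᶠ p in l, (scaledMatrix ρ₂ B₂ (τ p) (b p)).charpoly = ∏ m, (X - C (ξ p m)))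
    (hη' : ∀ᶠ p in l, (scaledMatrix ρ₂ B₂' (τ p) (b p)).charpoly = ∏ m, (X - C (η p m)))
    {κ : N₁ → N₂ → ℂ} (hκ : ∀ n m, κ n m = ∑ i ∈ Finset.univ.erase i₀, ρ₁ n i * a₀ i + ℓ m)
    (hκ0 : ∀ n m, κ n m ≠ 0)
    (hinj : ∀ n m n' m', κ n m * ρ₁ n' i₀ = κ n' m' * ρ₁ n i₀ → n = n' ∧ m = m') (m : N₂) :
    ∀ᶠ p in l, τ p ≠ 0 → ∀ w, w ≠ 0 →
      blochDet ρ₁ B₁ (Function.update ((τ p)⁻¹ • a p) i₀ w) (lam - ξ p m / τ p)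
        = blochDet ρ₁ B₁' (Function.update ((τ p)⁻¹ • a p) i₀ w) (lam - η p m / τ p) := by
  have flip (B : Matrix N₁ N₁ ℂ) (u : ι₁ → ℂ) (w x : ℂ) :=
    blochDet_update_inv hφ₀ hφ B u w x
  have hF' : ∀ u v, (∀ i, u i ≠ 0) → (∀ i, v i ≠ 0) → ∀ x,
      blochDet ρ₁ (B₁.submatrix φ φ) u (lam - x) = 0 → blochDet ρ₂ B₂ v x = 0 →
      ∃ y, blochDet ρ₁ (B₁'.submatrix φ φ) u (lam - y) = 0 ∧ blochDet ρ₂ B₂' v y = 0 := by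
    intro u v hu hv x h1 h2
    have key (B : Matrix N₁ N₁ ℂ) (x : ℂ) : blochDet ρ₁ (B.submatrix φ φ) u x
        = blochDet ρ₁ B (Function.update u i₀ (u i₀)⁻¹) x := by
      rw [flip, Function.update_eq_self]
    simp only [key] at h1 ⊢
    refine hF _ v (fun i => ?_) hv x h1 h2
    by_cases hi : i = i₀
    · subst hi
      simp [hu i]
    · simp [Function.update_of_ne hi, hu i]
  choose r hr hr0 using fun n => exists_tendsto_common_root hρ₁ i₀ hF ha₀ hτ ha hb hξ hη hξ' hη'
    hκ hκ0 hinj n m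
  choose s hs hs0 using fun n => exists_tendsto_common_root hρ₁ i₀ hF' ha₀ hτ ha hb hξ hη hξ' hη'
    hκ hκ0 hinj n m
  have hσ0 (n : N₁) : -ρ₁ n i₀ / κ n m ≠ 0 := div_ne_zero (neg_ne_zero.2 (hρ₁ n i₀)) (hκ0 n m)
  have hσ (n n' : N₁) (hn : n ≠ n') : -ρ₁ n i₀ / κ n m ≠ -ρ₁ n' i₀ / κ n' m := by
    intro h
    rw [div_eq_div_iff (hκ0 n m) (hκ0 n' m)] at h
    exact hn (hinj n m n' m (by linear_combination h)).1
  have hdist (t : N₁ → α → ℂ) (ht : ∀ n, Tendsto (t n) l (𝓝 (-ρ₁ n i₀ / κ n m))) :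
      ∀ᶠ p in l, Function.Injective fun n => t n p := by
    have : ∀ᶠ p in l, ∀ n n', n ≠ n' → t n p ≠ t n' p := by
      simp only [eventually_all]
      intro n n' hn
      exact ((ht n).prodMk_nhds (ht n')).eventually
        ((isOpen_ne_fun continuous_fst continuous_snd).mem_nhds (hσ n n' hn))
    filter_upwards [this] with p hp n n' h
    by_contra hn
    exact hp n n' hn h
  have hrs : ∀ᶠ p in l, ∀ n n', r n p * (s n' p * τ p ^ 2) ≠ 1 := by
    simp only [eventually_all]
    intro n n'
    refine ((hr n).mul ((hs n').mul (hτ.pow 2))).eventually_ne ?_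
    simp
  filter_upwards [hdist r hr, hdist s hs, hrs, eventually_all.2 hr0, eventually_all.2 hs0,
    eventually_all.2 fun n => (hr n).eventually_ne (hσ0 n),
    eventually_all.2 fun n => (hs n).eventually_ne (hσ0 n)] with
    p hrp hsp hrsp hrzp hszp hrnep hsnep hτp w hw
  obtain ⟨P, hPd, hP⟩ := exists_polynomial_det_pencil ρ₁ i₀ B₁ (τ p) (a p)
    (τ p * (lam - ξ p m / τ p))
  obtain ⟨P', hPd', hP'⟩ := exists_polynomial_det_pencil ρ₁ i₀ B₁' (τ p) (a p)
    (τ p * (lam - η p m / τ p))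
  have hPP : P = P' := by
    let z : Option (N₁ ⊕ N₁) → ℂ := fun o => o.elim 0
      (Sum.elim (fun n => r n p) (fun n => (s n p * τ p ^ 2)⁻¹))
    have hz : Function.Injective z := by
      have h0 : ∀ x, z (some x) ≠ 0 := by
        rintro (n | n) <;> simp [z, hrnep n, hsnep n, hτp]
      rintro (_ | x) (_ | y) hxy
      · rfl
      · exact absurd hxy.symm (h0 y)
      · exact absurd hxy (h0 x)
      · rcases x with x | x <;> rcases y with y | y
        · simp only [z, Option.elim_some, Sum.elim_inl] at hxy
          rw [hrp hxy]
        · simp only [z, Option.elim_some, Sum.elim_inl, Sum.elim_inr] at hxy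
          refine absurd ?_ (hrsp x y)
          rw [hxy, inv_mul_cancel₀ (mul_ne_zero (hsnep y) (pow_ne_zero 2 hτp))]
        · simp only [z, Option.elim_some, Sum.elim_inl, Sum.elim_inr] at hxy
          refine absurd ?_ (hrsp y x)
          rw [← hxy, inv_mul_cancel₀ (mul_ne_zero (hsnep x) (pow_ne_zero 2 hτp))]
        · simp only [z, Option.elim_some, Sum.elim_inr, inv_inj] at hxy
          rw [hsp (mul_right_cancel₀ (pow_ne_zero 2 hτp) hxy)]
    have hcard : 2 * Fintype.card N₁ < Fintype.card (Option (N₁ ⊕ N₁)) := by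
      simp [Fintype.card_option, Fintype.card_sum]
      omega
    refine eq_of_natDegree_lt_card_of_eval_eq P P' hz ?_
      (max_lt (hPd.trans_lt hcard) (hPd'.trans_lt hcard))
    rintro (_ | n | n)
    · simp only [z, Option.elim_none, hP, hP']
      congr 1
      ext i j
      simp [pencil]
    · simp only [z, Option.elim_some, Sum.elim_inl, hP, hP', (hrzp n hτp).1, (hrzp n hτp).2]
    · have hz0 : (s n p * τ p ^ 2)⁻¹ ≠ 0 := by simp [hsnep n, hτp]
      have hinv : ((s n p * τ p ^ 2)⁻¹ * τ p)⁻¹ = ((s n p * τ p)⁻¹)⁻¹ := by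
        field_simp
      have hsτ : (s n p * τ p) ^ Fintype.card N₁ ≠ 0 :=
        pow_ne_zero _ (mul_ne_zero (hsnep n) hτp)
      obtain ⟨h1, h2⟩ := hszp n hτp
      rw [det_pencil _ _ _ hτp (hsnep n), mul_eq_zero, or_iff_right hsτ] at h1 h2
      simp only [z, Option.elim_some, Sum.elim_inr, hP, hP']
      rw [det_pencil _ _ _ hτp hz0, det_pencil _ _ _ hτp hz0, hinv,
        flip B₁ _ (s n p * τ p)⁻¹ _, flip B₁' _ (s n p * τ p)⁻¹ _, h1, h2]
  have hσw : (w * τ p)⁻¹ ≠ 0 := by simp [hw, hτp]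
  have h1 := hP (w * τ p)⁻¹
  have h2 := hP' (w * τ p)⁻¹
  rw [det_pencil _ _ _ hτp hσw] at h1 h2
  have hww : ((w * τ p)⁻¹ * τ p)⁻¹ = w := by field_simp
  rw [hww] at h1 h2
  rw [hPP, h2] at h1
  exact (mul_left_cancel₀ (pow_ne_zero _ (mul_ne_zero hσw hτp)) h1).symm

end Matching

section Continuation

variable {ι N : Type*} [Fintype ι] [Fintype N] [DecidableEq N]

lemma exists_mvPolynomial_blochDet [DecidableEq ι] (ρ : N → ι → ℂ) (B : Matrix N N ℂ) (x : ℂ) :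
    ∃ P : MvPolynomial ι ℂ, ∀ u : ι → ℂ, (∀ i, u i ≠ 0) →
      MvPolynomial.eval u P = (∏ i, u i) ^ Fintype.card N * blochDet ρ B u x := by
  let S (n : N) : MvPolynomial ι ℂ := ∑ i, (MvPolynomial.C (ρ n i) * MvPolynomial.X i *
    ∏ j, MvPolynomial.X j + MvPolynomial.C (ρ n i)⁻¹ * ∏ j ∈ Finset.univ.erase i, MvPolynomial.X j)
  let M : Matrix N N (MvPolynomial ι ℂ) := Matrix.of fun n n' =>
    (if n = n' then MvPolynomial.C x * ∏ j, MvPolynomial.X j - S n else 0)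
      - MvPolynomial.C (B n n') * ∏ j, MvPolynomial.X j
  refine ⟨M.det, fun u hu => ?_⟩
  have hS (n : N) : MvPolynomial.eval u (S n) = (∏ i, u i) * blochSymbol ρ u n := by
    simp only [S, map_sum, map_add, map_mul, map_prod, MvPolynomial.eval_C, MvPolynomial.eval_X,
      blochSymbol, Finset.mul_sum]
    refine Finset.sum_congr rfl fun i _ => ?_
    rw [← Finset.mul_prod_erase Finset.univ u (Finset.mem_univ i), mul_inv]
    field_simp [hu i]
  rw [RingHom.map_det, blochDet_eq_det, ← Matrix.det_smul]
  congr 1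
  ext n n'
  by_cases h : n = n'
  · subst h
    simp [M, hS]
    ring
  · simp [M, h, Matrix.diagonal]
    ring

/-- Two determinants that agree near one point of the torus agree on the whole torus. -/
lemma blochDet_eq_of_eventually [DecidableEq ι] {ρ : N → ι → ℂ} {B B' : Matrix N N ℂ} {x y : ℂ}
    {u₀ : ι → ℂ}
    (hu₀ : ∀ i, u₀ i ≠ 0) (h : ∀ᶠ u in 𝓝 u₀, blochDet ρ B u x = blochDet ρ B' u y)
    {u : ι → ℂ} (hu : ∀ i, u i ≠ 0) : blochDet ρ B u x = blochDet ρ B' u y := by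
  obtain ⟨P, hP⟩ := exists_mvPolynomial_blochDet ρ B x
  obtain ⟨P', hP'⟩ := exists_mvPolynomial_blochDet ρ B' y
  have h0 : P - P' = 0 := by
    refine mvPolynomial_eq_zero_of_eventually (a := u₀) ?_
    have hne : ∀ᶠ u in 𝓝 u₀, ∀ i, u i ≠ 0 :=
      eventually_all.2 fun i => (continuous_apply i).continuousAt.eventually_ne (hu₀ i)
    filter_upwards [h, hne] with u hu1 hu2
    rw [map_sub, hP u hu2, hP' u hu2, hu1, sub_self]
  have h1 := hP u hu
  rw [sub_eq_zero.1 h0, hP' u hu] at h1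
  exact (mul_left_cancel₀ (pow_ne_zero _ (Finset.prod_ne_zero_iff.2 fun i _ => hu i)) h1).symm

/-- At a point where exactly one leading form vanishes, the leading coefficient of the determinant
detects the corresponding diagonal entry of `B`. -/
lemma diag_sub_eq_of_blochDet_eq {ρ : N → ι → ℂ} {B B' : Matrix N N ℂ} {x y : ℂ}
    (h : ∀ u, (∀ i, u i ≠ 0) → blochDet ρ B u x = blochDet ρ B' u y) {n₀ : N} {a : ι → ℂ}
    (ha : ∀ i, a i ≠ 0) (h0 : ∑ i, ρ n₀ i * a i = 0)
    (hne : ∀ n, n ≠ n₀ → ∑ i, ρ n i * a i ≠ 0) : x - B n₀ n₀ = y - B' n₀ n₀ := by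
  let R (n : N) : ℂ := ∑ i, (ρ n i * a i)⁻¹
  let row (B : Matrix N N ℂ) (x τ : ℂ) : N → ℂ := fun n' =>
    (if n₀ = n' then x - τ * R n₀ else 0) - B n₀ n'
  let M (B : Matrix N N ℂ) (x τ : ℂ) : Matrix N N ℂ :=
    (Matrix.scalar N (τ * x) - scaledMatrix ρ B τ a).updateRow n₀ (row B x τ)
  have hM (B : Matrix N N ℂ) (x τ : ℂ) (hτ : τ ≠ 0) :
      τ * (M B x τ).det = τ ^ Fintype.card N * blochDet ρ B (τ⁻¹ • a) x := by
    rw [← eval_charpoly_scaledMatrix ρ B hτ, Matrix.eval_charpoly, ← Matrix.det_updateRow_smul]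
    congr 1
    ext n n'
    by_cases hn : n = n₀
    · subst hn
      rw [Matrix.updateRow_self]
      by_cases hn' : n = n'
      · subst hn'
        simp [row, scaledMatrix, Finset.sum_add_distrib, h0, R, ← Finset.mul_sum]
        ring
      · simp [row, scaledMatrix, hn', Matrix.diagonal]
    · simp [Matrix.updateRow_ne hn]
  have hM0 (B : Matrix N N ℂ) (x : ℂ) : (M B x 0).det
      = (∏ n ∈ Finset.univ.erase n₀, -∑ i, ρ n i * a i) * (x - B n₀ n₀) := by
    have e : Matrix.scalar N (0 * x) - scaledMatrix ρ B 0 a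
        = (Matrix.diagonal fun n => -∑ i, ρ n i * a i).transpose := by
      ext n n'
      by_cases hn : n = n' <;> simp [scaledMatrix, hn, Matrix.diagonal]
      intro h
      exact absurd h.symm hn
    simp only [M]
    rw [e, ← Matrix.cramer_transpose_apply, Matrix.transpose_transpose,
      Matrix.cramer_eq_adjugate_mulVec, Matrix.adjugate_diagonal, Matrix.mulVec_diagonal]
    simp [row]
  have hcont (B : Matrix N N ℂ) (x : ℂ) :
      Tendsto (fun τ => (M B x τ).det) (𝓝[≠] 0) (𝓝 (M B x 0).det) := by
    refine Tendsto.mono_left (Continuous.tendsto ?_ 0) nhdsWithin_le_nhds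
    refine Continuous.matrix_det (continuous_matrix fun n n' => ?_)
    by_cases hn : n = n₀
    · simp only [M, hn, Matrix.updateRow_self, row]
      split_ifs <;> fun_prop
    · simp only [M, Matrix.updateRow_ne hn, scaledMatrix, Matrix.sub_apply, Matrix.add_apply,
        Matrix.scalar_apply, Matrix.diagonal_apply, Matrix.smul_apply, smul_eq_mul]
      split_ifs <;> fun_prop
  have heq : (M B x 0).det = (M B' y 0).det := by
    refine tendsto_nhds_unique (hcont B x) ((hcont B' y).congr' ?_)
    filter_upwards [self_mem_nhdsWithin] with τ (hτ : τ ≠ 0)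
    refine mul_left_cancel₀ hτ ?_
    rw [hM B' y τ hτ, hM B x τ hτ, h _ fun i => by simp [hτ, ha i]]
  rw [hM0, hM0] at heq
  exact mul_left_cancel₀ (Finset.prod_ne_zero_iff.2 fun n hn =>
    neg_ne_zero.2 (hne n (Finset.ne_of_mem_erase hn))) heq

end Continuation

section Shift

variable {ι₁ ι₂ N₁ N₂ : Type*} [Fintype ι₁] [DecidableEq ι₁] [Fintype ι₂] [DecidableEq ι₂]
  [Fintype N₁] [DecidableEq N₁] [Fintype N₂] [DecidableEq N₂]

/-- If the pairs `(B₁, B₂)` and `(B₁', B₂')` have nested zero sets at one energy, then under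
genericity of the phases both blocks agree up to opposite shifts of the spectral parameter. -/
theorem blochDet_shift {ρ₁ : N₁ → ι₁ → ℂ} {ρ₂ : N₂ → ι₂ → ℂ}
    (hρ₁ : ∀ n i, ρ₁ n i ≠ 0) (hρ₂ : ∀ n i, ρ₂ n i ≠ 0) {i₀ : ι₁} {φ : Equiv.Perm N₁}
    (hφ₀ : ∀ n, ρ₁ (φ n) i₀ = (ρ₁ n i₀)⁻¹) (hφ : ∀ n, ∀ i ≠ i₀, ρ₁ (φ n) i = ρ₁ n i)
    {B₁ B₁' : Matrix N₁ N₁ ℂ} {B₂ B₂' : Matrix N₂ N₂ ℂ} {lam : ℂ}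
    (hF : ∀ u v, (∀ i, u i ≠ 0) → (∀ i, v i ≠ 0) → ∀ x, blochDet ρ₁ B₁ u (lam - x) = 0 →
      blochDet ρ₂ B₂ v x = 0 → ∃ y, blochDet ρ₁ B₁' u (lam - y) = 0 ∧ blochDet ρ₂ B₂' v y = 0)
    {a₀ : ι₁ → ℂ} {b₀ : ι₂ → ℂ} (ha₀ : ∀ i, a₀ i ≠ 0) (hb₀ : ∀ i, b₀ i ≠ 0)
    {κ : N₁ → N₂ → ℂ}
    (hκ : ∀ n m, κ n m = ∑ i ∈ Finset.univ.erase i₀, ρ₁ n i * a₀ i + ∑ i, ρ₂ m i * b₀ i)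
    (hκ0 : ∀ n m, κ n m ≠ 0)
    (hinj : ∀ n m n' m', κ n m * ρ₁ n' i₀ = κ n' m' * ρ₁ n i₀ → n = n' ∧ m = m')
    {m₀ : N₂} (hm₀ : ∑ i, ρ₂ m₀ i * b₀ i ≠ 0) {n₀ : N₁} {a : ι₁ → ℂ} (ha : ∀ i, a i ≠ 0)
    (h0 : ∑ i, ρ₁ n₀ i * a i = 0) (hne : ∀ n, n ≠ n₀ → ∑ i, ρ₁ n i * a i ≠ 0)
    {c : ℂ} (hc : B₁ n₀ n₀ - B₁' n₀ n₀ = c) :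
    (∀ u, (∀ i, u i ≠ 0) → ∀ x, blochDet ρ₁ B₁ u x = blochDet ρ₁ B₁' u (x - c)) ∧
    (∀ v, (∀ i, v i ≠ 0) → ∀ x, blochDet ρ₂ B₂ v x = blochDet ρ₂ B₂' v (x + c)) := by
  set ℓ : N₂ → ℂ := fun m => ∑ i, ρ₂ m i * b₀ i with hℓ
  have hℓinj : Function.Injective ℓ := fun m m' h =>
    (hinj n₀ m n₀ m' (by rw [hκ, hκ]; simp only [hℓ] at h; rw [h])).2
  have hroots (B : Matrix N₂ N₂ ℂ) := exists_tendsto_prod_X_sub_C (l := 𝓝 ((0 : ℂ), b₀))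
    (P := fun p => (scaledMatrix ρ₂ B p.1 p.2).charpoly) hℓinj
    (fun p => Matrix.charpoly_monic _) (fun p => Matrix.charpoly_natDegree_eq_dim _)
    (fun m => by
      have := (continuousAt_charpoly_scaledMatrix hρ₂ B hb₀ (ℓ m)).tendsto
      rw [charpoly_scaledMatrix_zero, Finset.prod_eq_zero (Finset.mem_univ m) (by simp [hℓ])]
        at this
      exact this)
  obtain ⟨ξ, hξ', hξ⟩ := hroots B₂
  obtain ⟨η, hη', hη⟩ := hroots B₂'
  have hbne : ∀ᶠ p in 𝓝 ((0 : ℂ), b₀), ∀ i, p.2 i ≠ 0 :=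
    eventually_all.2 fun i => ((continuous_apply i).comp continuous_snd).continuousAt.eventually_ne
      (hb₀ i)
  have hfst : Tendsto (Prod.fst : (ℂ × (ι₂ → ℂ)) × (ι₁ → ℂ) → _) (𝓝 ((0 : ℂ), b₀) ×ˢ 𝓝 a₀)
    (𝓝 ((0 : ℂ), b₀)) := tendsto_fst
  have hall : ∀ᶠ p in 𝓝 ((0 : ℂ), b₀), p.1 ≠ 0 → ∀ m, ∀ u, (∀ i, u i ≠ 0) →
      blochDet ρ₁ B₁ u (lam - ξ p m / p.1) = blochDet ρ₁ B₁' u (lam - η p m / p.1) := by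
    have h1 (m : N₂) := (eventually_blochDet_eq hρ₁ hφ₀ hφ hF
      (l := 𝓝 ((0 : ℂ), b₀) ×ˢ 𝓝 a₀) (τ := fun p => p.1.1) (a := fun p => p.2)
      (b := fun p => p.1.2) (ξ := fun p => ξ p.1) (η := fun p => η p.1) ha₀
      ((continuous_fst.tendsto ((0 : ℂ), b₀)).comp hfst) tendsto_snd
      (hfst.eventually hbne) (fun m => (hξ m).comp hfst) (fun m => (hη m).comp hfst)
      (hfst.eventually hξ') (hfst.eventually hη') hκ hκ0 hinj m).curry
    filter_upwards [eventually_all.2 h1] with p hp hτ m u hu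
    refine blochDet_eq_of_eventually (u₀ := p.1⁻¹ • a₀) (fun i => by simp [hτ, ha₀ i]) ?_ hu
    have ht : Tendsto (fun u : ι₁ → ℂ => p.1 • u) (𝓝 (p.1⁻¹ • a₀)) (𝓝 a₀) := by
      have : Continuous fun u : ι₁ → ℂ => p.1 • u := by fun_prop
      simpa [smul_smul, hτ] using this.tendsto (p.1⁻¹ • a₀)
    have hai : ∀ᶠ u in 𝓝 (p.1⁻¹ • a₀), u i₀ ≠ 0 :=
      (continuous_apply i₀).continuousAt.eventually_ne (by simp [hτ, ha₀ i₀])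
    filter_upwards [ht.eventually (hp m), hai] with u hu1 hu2
    have := hu1 hτ (u i₀) hu2
    simpa [smul_smul, hτ] using this
  have hshift : ∀ᶠ p in 𝓝 ((0 : ℂ), b₀), p.1 ≠ 0 → ∀ m, η p m = ξ p m + c * p.1 := by
    filter_upwards [hall] with p hp hτ m
    have := diag_sub_eq_of_blochDet_eq (hp hτ m) ha h0 hne
    have h2 : η p m / p.1 = ξ p m / p.1 + c := by rw [← hc]; linear_combination this
    field_simp at h2
    linear_combination h2
  constructor
  · intro u hu
    let D : ℂ[X] := (Matrix.diagonal (blochSymbol ρ₁ u) + B₁).charpoly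
      - (Matrix.diagonal (blochSymbol ρ₁ u) + B₁').charpoly.comp (X - C c)
    have hD (x : ℂ) : D.eval x = blochDet ρ₁ B₁ u x - blochDet ρ₁ B₁' u (x - c) := by
      simp [D, blochDet]
    have hD0 : D = 0 := by
      by_contra hD0
      have hr : ∀ᶠ p in 𝓝 ((0 : ℂ), b₀), ∀ r ∈ D.roots.toFinset,
          ξ p m₀ - p.1 * (lam - r) ≠ 0 := by
        refine (eventually_all_finset _).2 fun r _ => ?_
        have := (hξ m₀).sub ((continuous_fst.tendsto ((0 : ℂ), b₀)).mul_const (lam - r))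
        exact this.eventually_ne (by simpa [hℓ] using hm₀)
      have hpair : Tendsto (fun τ : ℂ => (τ, b₀)) (𝓝[≠] 0) (𝓝 ((0 : ℂ), b₀)) :=
        ((by fun_prop : Continuous fun τ : ℂ => (τ, b₀)).tendsto 0).mono_left nhdsWithin_le_nhds
      obtain ⟨τ, hτ, h1, h2, h3⟩ := ((eventually_mem_nhdsWithin (a := (0 : ℂ)) (s := {0}ᶜ)).and
        ((hpair.eventually hr).and
          ((hpair.eventually hall).and (hpair.eventually hshift)))).exists
      have hτ : τ ≠ 0 := hτ
      have h4 : D.eval (lam - ξ (τ, b₀) m₀ / τ) = 0 := by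
        have h5 := h2 hτ m₀ u hu
        rw [h3 hτ m₀] at h5
        rw [hD, h5, sub_eq_zero]
        congr 1
        field_simp
        ring
      refine h1 _ (by simpa [hD0] using h4) ?_
      field_simp
      ring
    intro x
    have := hD x
    rw [hD0, eval_zero] at this
    exact sub_eq_zero.1 this.symm
  · have hall2 : ∀ᶠ p in 𝓝 (0 : ℂ) ×ˢ 𝓝 b₀, p.1 ≠ 0 → ∀ x,
        blochDet ρ₂ B₂ (p.1⁻¹ • p.2) x = blochDet ρ₂ B₂' (p.1⁻¹ • p.2) (x + c) := by
      rw [← nhds_prod_eq]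
      filter_upwards [hξ', hη', hshift] with p h1 h2 h3 hτ x
      refine mul_left_cancel₀ (pow_ne_zero (Fintype.card N₂) hτ) ?_
      rw [← eval_charpoly_scaledMatrix _ _ hτ, ← eval_charpoly_scaledMatrix _ _ hτ, h1, h2,
        eval_prod, eval_prod]
      refine Finset.prod_congr rfl fun m _ => ?_
      simp [h3 hτ m]
      ring
    obtain ⟨τ, hτ, h1⟩ := ((eventually_mem_nhdsWithin (a := (0 : ℂ)) (s := {0}ᶜ)).and
      (hall2.curry.filter_mono nhdsWithin_le_nhds)).exists
    have hτ : τ ≠ 0 := hτ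
    intro v hv x
    refine blochDet_eq_of_eventually (u₀ := τ⁻¹ • b₀) (fun i => by simp [hτ, hb₀ i]) ?_ hv
    have ht : Tendsto (fun u : ι₂ → ℂ => τ • u) (𝓝 (τ⁻¹ • b₀)) (𝓝 b₀) := by
      have : Continuous fun u : ι₂ → ℂ => τ • u := by fun_prop
      simpa [smul_smul, hτ] using this.tendsto (τ⁻¹ • b₀)
    filter_upwards [ht.eventually h1] with u hu
    simpa [smul_smul, hτ] using hu hτ x

end Shift

section Coprime

/-- The phases `e^{2πi nᵢ / qᵢ}`. -/
def phase {ι : Type*} (q : ι → ℕ) [∀ i, NeZero (q i)] (n : ∀ i, ZMod (q i)) (i : ι) : ℂ :=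
  ZMod.stdAddChar (n i)

lemma phase_ne_zero {ι : Type*} (q : ι → ℕ) [∀ i, NeZero (q i)] (n : ∀ i, ZMod (q i)) (i : ι) :
    phase q n i ≠ 0 := by
  rw [phase, ZMod.stdAddChar_apply]
  exact Circle.coe_ne_zero _

@[simp]
lemma phase_zero {ι : Type*} (q : ι → ℕ) [∀ i, NeZero (q i)] (i : ι) : phase q 0 i = 1 :=
  AddChar.map_zero_eq_one _

lemma eq_zero_of_stdAddChar_eq {p q : ℕ} [NeZero p] [NeZero q] (h : Nat.Coprime p q)
    {x : ZMod p} {y : ZMod q} (hxy : (ZMod.stdAddChar x : ℂ) = ZMod.stdAddChar y) : y = 0 := by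
  have hp : (ZMod.stdAddChar (p • y) : ℂ) = 1 := by
    rw [AddChar.map_nsmul_eq_pow, ← hxy, ← AddChar.map_nsmul_eq_pow]
    simp
  have h0 : p • y = 0 := ZMod.injective_stdAddChar (by rw [hp, AddChar.map_zero_eq_one])
  rw [nsmul_eq_mul] at h0
  exact ((ZMod.isUnit_iff_coprime p q).2 h).mul_right_eq_zero.1 h0

lemma eq_of_stdAddChar_mul_eq {p q : ℕ} [NeZero p] [NeZero q] (h : Nat.Coprime p q)
    {x x' : ZMod p} {y y' : ZMod q}
    (hxy : (ZMod.stdAddChar x : ℂ) * ZMod.stdAddChar y' = ZMod.stdAddChar x' * ZMod.stdAddChar y) :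
    y = y' := by
  refine sub_eq_zero.1 (eq_zero_of_stdAddChar_eq h (x := x - x') ?_)
  rw [AddChar.map_sub_eq_div, AddChar.map_sub_eq_div, div_eq_div_iff, hxy, mul_comm]
  all_goals
    rw [ZMod.stdAddChar_apply]
    exact Circle.coe_ne_zero _

variable {ι₁ ι₂ : Type*} [Fintype ι₁] [DecidableEq ι₁] [Fintype ι₂] [DecidableEq ι₂]

lemma sum_ite_mul_eq_sum_erase (i₀ : ι₁) (c a : ι₁ → ℂ) :
    ∑ i, (if i = i₀ then 0 else c i) * a i = ∑ i ∈ Finset.univ.erase i₀, c i * a i := by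
  rw [← Finset.add_sum_erase _ _ (Finset.mem_univ i₀)]
  simp only [if_true, zero_mul, zero_add]
  exact Finset.sum_congr rfl fun i hi => by rw [if_neg (Finset.ne_of_mem_erase hi)]

/-- The shift theorem for the phases of pairwise coprime periods. -/
theorem blochDet_shift_of_coprime {q₁ : ι₁ → ℕ} {q₂ : ι₂ → ℕ} [∀ i, NeZero (q₁ i)]
    [∀ i, NeZero (q₂ i)] (h₁₁ : ∀ i i', i ≠ i' → Nat.Coprime (q₁ i) (q₁ i'))
    {i₀ i₁ : ι₁} (hi : i₁ ≠ i₀) (j₀ : ι₂)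
    {B₁ B₁' : Matrix (∀ i, ZMod (q₁ i)) (∀ i, ZMod (q₁ i)) ℂ}
    {B₂ B₂' : Matrix (∀ i, ZMod (q₂ i)) (∀ i, ZMod (q₂ i)) ℂ} {lam : ℂ}
    (hF : ∀ u v, (∀ i, u i ≠ 0) → (∀ i, v i ≠ 0) → ∀ x, blochDet (phase q₁) B₁ u (lam - x) = 0 →
      blochDet (phase q₂) B₂ v x = 0 →
      ∃ y, blochDet (phase q₁) B₁' u (lam - y) = 0 ∧ blochDet (phase q₂) B₂' v y = 0)
    {c : ℂ} (hc : B₁ 0 0 - B₁' 0 0 = c) :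
    (∀ u, (∀ i, u i ≠ 0) → ∀ x,
      blochDet (phase q₁) B₁ u x = blochDet (phase q₁) B₁' u (x - c)) ∧
    (∀ v, (∀ i, v i ≠ 0) → ∀ x,
      blochDet (phase q₂) B₂ v x = blochDet (phase q₂) B₂' v (x + c)) := by
  have key {n n' : (∀ i, ZMod (q₁ i))} (h : ∀ i, i ≠ i₀ → phase q₁ n i * phase q₁ n' i₀
      = phase q₁ n' i * phase q₁ n i₀) : n = n' := by
    have h0 : n i₀ = n' i₀ := eq_of_stdAddChar_mul_eq (h₁₁ _ _ hi) (h i₁ hi)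
    ext i
    by_cases hii : i = i₀
    · rw [hii, h0]
    · have := h i hii
      simp only [phase, h0] at this
      exact ZMod.injective_stdAddChar (mul_right_cancel₀ (phase_ne_zero q₁ n' i₀) this)
  -- coefficient vectors of the finitely many linear forms that must not vanish
  let form (c : ι₁ → ℂ) (e : ι₂ → ℂ) : ι₁ ⊕ ι₂ → ℂ :=
    Sum.elim (fun i => if i = i₀ then 0 else c i) e
  have hform (c : ι₁ → ℂ) (e : ι₂ → ℂ) (x : ι₁ ⊕ ι₂ → ℂ) : ∑ k, form c e k * x k
      = ∑ i ∈ Finset.univ.erase i₀, c i * x (Sum.inl i) + ∑ j, e j * x (Sum.inr j) := by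
    simp only [form, Fintype.sum_sum_type, Sum.elim_inl, Sum.elim_inr]
    rw [sum_ite_mul_eq_sum_erase i₀ c fun i => x (Sum.inl i)]
  have hform0 {c : ι₁ → ℂ} {e : ι₂ → ℂ} (h : form c e = 0) :
      (∀ i, i ≠ i₀ → c i = 0) ∧ ∀ j, e j = 0 :=
    ⟨fun i hi' => by simpa [form, hi'] using congrFun h (Sum.inl i),
      fun j => by simpa [form] using congrFun h (Sum.inr j)⟩
  let P := (∀ i, ZMod (q₁ i)) × (∀ i, ZMod (q₂ i))
  let K := {p : P × P // p.1 ≠ p.2} ⊕ P ⊕ (ι₁ ⊕ ι₂) ⊕ {n : ∀ i, ZMod (q₁ i) // n ≠ 0} ⊕ Bool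
  let v : K → ι₁ ⊕ ι₂ → ℂ := Sum.elim
    (fun p => form
      (fun i => phase q₁ p.1.1.1 i * phase q₁ p.1.2.1 i₀ - phase q₁ p.1.2.1 i * phase q₁ p.1.1.1 i₀)
      (fun j => phase q₂ p.1.1.2 j * phase q₁ p.1.2.1 i₀
        - phase q₂ p.1.2.2 j * phase q₁ p.1.1.1 i₀))
    (Sum.elim (fun p => form (phase q₁ p.1) (phase q₂ p.2))
    (Sum.elim (fun k => Pi.single k 1)
    (Sum.elim (fun n => form (fun i => phase q₁ n.1 i - phase q₁ n.1 i₀) 0)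
    (fun b => bif b then form 1 0 else form 0 (phase q₂ 0)))))
  obtain ⟨x, hx⟩ := exists_forall_sum_mul_ne_zero v (by
    rintro (⟨⟨⟨n, m⟩, n', m'⟩, hne⟩ | ⟨n, m⟩ | k | ⟨n, hn⟩ | b) h
    · obtain ⟨h1, h2⟩ := hform0 h
      have hn : n = n' := key fun i hi' => sub_eq_zero.1 (h1 i hi')
      refine hne (Prod.ext hn (funext fun j => ZMod.injective_stdAddChar ?_))
      have := sub_eq_zero.1 (h2 j)
      simp only [hn] at this
      exact mul_right_cancel₀ (phase_ne_zero q₁ n' i₀) this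
    · exact phase_ne_zero _ _ _ ((hform0 h).1 i₁ hi)
    · simpa [v] using congrFun h k
    · refine hn (key fun i hi' => ?_)
      have := (hform0 h).1 i hi'
      rw [phase_zero, phase_zero]
      linear_combination this
    · cases b
      · exact phase_ne_zero _ _ _ ((hform0 h).2 j₀)
      · exact one_ne_zero ((hform0 h).1 i₁ hi))
  let φ : Equiv.Perm (∀ i, ZMod (q₁ i)) := Function.Involutive.toPerm
    (fun n => Function.update n i₀ (-n i₀)) fun n => by simp
  have hx0 (k : ι₁ ⊕ ι₂) : x k ≠ 0 := by
    have := hx (Sum.inr (Sum.inr (Sum.inl k)))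
    simpa [v, Pi.single_apply] using this
  have hs : ∑ i ∈ Finset.univ.erase i₀, x (Sum.inl i) ≠ 0 := by
    have := hx (Sum.inr (Sum.inr (Sum.inr (Sum.inr true))))
    change ∑ k, form 1 0 k * x k ≠ 0 at this
    rw [hform] at this
    simpa using this
  have hsum (n : (∀ i, ZMod (q₁ i))) :
      ∑ i, phase q₁ n i * Function.update (fun i => x (Sum.inl i)) i₀
        (-∑ i ∈ Finset.univ.erase i₀, x (Sum.inl i)) i
      = ∑ i ∈ Finset.univ.erase i₀, (phase q₁ n i - phase q₁ n i₀) * x (Sum.inl i) := by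
    rw [← Finset.add_sum_erase _ _ (Finset.mem_univ i₀), Function.update_self]
    simp only [sub_mul, Finset.sum_sub_distrib, ← Finset.mul_sum]
    have e : ∀ i ∈ Finset.univ.erase i₀, phase q₁ n i * Function.update (fun i => x (Sum.inl i)) i₀
        (-∑ i ∈ Finset.univ.erase i₀, x (Sum.inl i)) i = phase q₁ n i * x (Sum.inl i) :=
      fun i hi' => by rw [Function.update_of_ne (Finset.ne_of_mem_erase hi')]
    rw [Finset.sum_congr rfl e]
    ring
  refine blochDet_shift (φ := φ) (i₀ := i₀) (phase_ne_zero q₁) (phase_ne_zero q₂) (fun n => ?_)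
    (fun n i hi' => ?_) hF (a₀ := fun i => x (Sum.inl i)) (b₀ := fun j => x (Sum.inr j))
    (fun i => hx0 _) (fun j => hx0 _) (fun n m => rfl) (fun n m => ?_) (fun n m n' m' h => ?_)
    (m₀ := 0) ?_ (n₀ := 0) (a := Function.update (fun i => x (Sum.inl i)) i₀
      (-∑ i ∈ Finset.univ.erase i₀, x (Sum.inl i))) (fun i => ?_) ?_ (fun n hn => ?_) hc
  · change ZMod.stdAddChar (Function.update n i₀ (-n i₀) i₀) = _
    rw [Function.update_self, AddChar.map_neg_eq_inv, phase]
  · change ZMod.stdAddChar (Function.update n i₀ (-n i₀) i) = _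
    rw [Function.update_of_ne hi', phase]
  · rw [← hform]
    exact hx (Sum.inr (Sum.inl (n, m)))
  · rw [← Prod.mk_inj]
    by_contra hne
    refine hx (Sum.inl ⟨((n, m), (n', m')), hne⟩) ?_
    refine (hform _ _ x).trans ?_
    rw [← sub_eq_zero, add_mul, add_mul, Finset.sum_mul, Finset.sum_mul, Finset.sum_mul,
      Finset.sum_mul] at h
    rw [← h, add_sub_add_comm, ← Finset.sum_sub_distrib, ← Finset.sum_sub_distrib]
    congr 1 <;> refine Finset.sum_congr rfl fun _ _ => ?_ <;> ring
  · have := hx (Sum.inr (Sum.inr (Sum.inr (Sum.inr false))))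
    change ∑ k, form 0 (phase q₂ 0) k * x k ≠ 0 at this
    rw [hform] at this
    simpa using this
  · by_cases hi' : i = i₀
    · subst hi'
      rwa [Function.update_self, neg_ne_zero]
    · simpa [hi'] using hx0 (Sum.inl i)
  · rw [hsum]
    simp [phase]
  · rw [hsum]
    have := hx (Sum.inr (Sum.inr (Sum.inr (Sum.inl ⟨n, hn⟩))))
    change ∑ k, form (fun i => phase q₁ n i - phase q₁ n i₀) 0 k * x k ≠ 0 at this
    rw [hform] at this
    simpa using this

end Coprime

section Fourier

lemma prod_natCast_ne_zero {ι : Type*} [Fintype ι] (q : ι → ℕ) [∀ i, NeZero (q i)] :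
    (∏ i, (q i : ℂ)) ≠ 0 :=
  Finset.prod_ne_zero_iff.2 fun i _ => Nat.cast_ne_zero.2 (NeZero.ne (q i))

variable {ι : Type*} [Fintype ι] [DecidableEq ι] (q : ι → ℕ) [∀ i, NeZero (q i)]

/-- The Floquet matrix for coordinates indexed by an arbitrary finite type. -/
def floquetMatrix (V : (∀ i, ZMod (q i)) → ℂ) (z : ι → ℂ) :
    Matrix (∀ i, ZMod (q i)) (∀ i, ZMod (q i)) ℂ :=
  fun n n' =>
    (∑ j : ι,
      ((if n' = n + Pi.single j 1 then (if (n j).val = q j - 1 then z j else 1) else 0)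
        + (if n' = n - Pi.single j 1 then (if (n j).val = 0 then (z j)⁻¹ else 1) else 0)))
    + (if n' = n then V n else 0)

lemma val_eq_pred_iff {p : ℕ} [NeZero p] (x : ZMod p) : x.val = p - 1 ↔ x + 1 = 0 := by
  obtain ⟨k, rfl⟩ := Nat.exists_eq_succ_of_ne_zero (NeZero.ne p)
  rw [← eq_neg_iff_add_eq_zero, ← (ZMod.val_injective _).eq_iff, ZMod.val_neg_one]
  rfl

lemma mul_pow_val_add_one {p : ℕ} [NeZero p] (w : ℂ) (k x : ZMod p) :
    (if x + 1 = 0 then w ^ p else 1) * (w ^ (x + 1).val * ZMod.stdAddChar (k * (x + 1)))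
      = ZMod.stdAddChar k * w * (w ^ x.val * ZMod.stdAddChar (k * x)) := by
  rw [mul_add, mul_one, AddChar.map_add_eq_mul]
  have hp : p = p - 1 + 1 := (Nat.succ_pred_eq_of_ne_zero (NeZero.ne p)).symm
  split_ifs with h
  · rw [h, ZMod.val_zero, (val_eq_pred_iff x).2 h]
    nth_rw 1 [hp]
    ring
  · have h1 : x.val ≠ p - 1 := mt (val_eq_pred_iff x).1 h
    have h2 : (x + 1).val = x.val + 1 := by
      have hlt := x.val_lt
      have hone : (1 : ZMod p).val = 1 := by
        rw [ZMod.val_one_eq_one_mod, Nat.mod_eq_of_lt (by omega)]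
      rw [ZMod.val_add_of_lt (by omega), hone]
    rw [h2]
    ring

lemma mul_pow_val_sub_one {p : ℕ} [NeZero p] {w : ℂ} (hw : w ≠ 0) (k x : ZMod p) :
    (if x = 0 then (w ^ p)⁻¹ else 1) * (w ^ (x - 1).val * ZMod.stdAddChar (k * (x - 1)))
      = (ZMod.stdAddChar k * w)⁻¹ * (w ^ x.val * ZMod.stdAddChar (k * x)) := by
  have h := mul_pow_val_add_one w k (x - 1)
  have hk : (ZMod.stdAddChar k : ℂ) ≠ 0 := phase_ne_zero (fun _ : Unit => p) (fun _ => k) ()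
  rw [sub_add_cancel] at h
  split_ifs at h ⊢ with hx
  · have : w ^ p ≠ 0 := pow_ne_zero _ hw
    field_simp
    linear_combination -h
  · field_simp
    linear_combination -h

lemma mul_prod_add_single {ι : Type*} [Fintype ι] [DecidableEq ι] {q : ι → ℕ} {n : ∀ i, ZMod (q i)}
    {j : ι} {s : ZMod (q j)} (g : ∀ i, ZMod (q i) → ℂ) {c t : ℂ}
    (h : c * g j (n j + s) = t * g j (n j)) :
    c * ∏ i, g i ((n + Pi.single j s : ∀ i, ZMod (q i)) i) = t * ∏ i, g i (n i) := by
  rw [← Finset.mul_prod_erase _ _ (Finset.mem_univ j),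
    ← Finset.mul_prod_erase _ (fun i => g i (n i)) (Finset.mem_univ j), ← mul_assoc, ← mul_assoc]
  have e : ∀ i ∈ Finset.univ.erase j,
      g i ((n + Pi.single j s : ∀ i, ZMod (q i)) i) = g i (n i) := fun i hi => by
    simp [Finset.ne_of_mem_erase hi]
  rw [Finset.prod_congr rfl e, ← h]
  simp

/-- The matrix of the Fourier transform on `∏ i, ZMod (q i)`. -/
def fourierMatrix : Matrix (∀ i, ZMod (q i)) (∀ i, ZMod (q i)) ℂ :=
  fun n k => ∏ i, ZMod.stdAddChar (k i * n i)

/-- The inverse of `fourierMatrix`. -/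
def fourierMatrixInv : Matrix (∀ i, ZMod (q i)) (∀ i, ZMod (q i)) ℂ :=
  fun k n => (∏ i, (q i : ℂ))⁻¹ * ∏ i, ZMod.stdAddChar (-(k i * n i))

lemma fourierMatrix_mul_inv : fourierMatrix q * fourierMatrixInv q = 1 := by
  ext n n'
  rw [Matrix.mul_apply]
  have h1 (k : ∀ i, ZMod (q i)) : fourierMatrix q n k * fourierMatrixInv q k n'
      = (∏ i, (q i : ℂ))⁻¹ * ∏ i, ZMod.stdAddChar (k i * (n i - n' i)) := by
    rw [fourierMatrix, fourierMatrixInv, mul_left_comm, ← Finset.prod_mul_distrib]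
    congr 1
    refine Finset.prod_congr rfl fun i _ => ?_
    rw [← AddChar.map_add_eq_mul]
    ring_nf
  have h2 : ∑ k : ∀ i, ZMod (q i), ∏ i, (ZMod.stdAddChar (k i * (n i - n' i)) : ℂ)
      = ∏ i, ∑ x : ZMod (q i), (ZMod.stdAddChar (x * (n i - n' i)) : ℂ) := by
    rw [Finset.prod_univ_sum, Fintype.piFinset_univ]
  simp only [h1]
  rw [← Finset.mul_sum, h2]
  simp only [AddChar.sum_mulShift _ (ZMod.isPrimitive_stdAddChar _), sub_eq_zero, ZMod.card]
  by_cases h : n = n'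
  · subst h
    simp [prod_natCast_ne_zero q]
  · obtain ⟨i, hi⟩ := Function.ne_iff.1 h
    rw [Matrix.one_apply_ne h]
    refine mul_eq_zero_of_right _ (Finset.prod_eq_zero (Finset.mem_univ i) ?_)
    simp [hi]

/-- Conjugation by the twisted Fourier transform diagonalizes the free part. -/
lemma charpoly_floquetMatrix (V : (∀ i, ZMod (q i)) → ℂ) {w : ι → ℂ} (hw : ∀ i, w i ≠ 0) :
    (floquetMatrix q V fun i => w i ^ q i).charpoly
      = (Matrix.diagonal (blochSymbol (phase q) w)
        + fourierMatrixInv q * Matrix.diagonal V * fourierMatrix q).charpoly := by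
  set F := fourierMatrix q with hF
  set F' := fourierMatrixInv q
  have hFF : F * F' = 1 := fourierMatrix_mul_inv q
  let E : (∀ i, ZMod (q i)) → ℂ := fun n => ∏ i, w i ^ (n i).val
  have hE (n) : E n ≠ 0 := Finset.prod_ne_zero_iff.2 fun i _ => pow_ne_zero _ (hw i)
  let G := Matrix.diagonal E * F
  let G' := F' * Matrix.diagonal fun n => (E n)⁻¹
  have hGG : G * G' = 1 := by
    simp only [G, G']
    rw [Matrix.mul_assoc, ← Matrix.mul_assoc F, hFF, Matrix.one_mul, Matrix.diagonal_mul_diagonal]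
    simp [hE]
  have hfree : floquetMatrix q 0 (fun i => w i ^ q i) * G
      = G * Matrix.diagonal (blochSymbol (phase q) w) := by
    ext n k
    let g (i : ι) (x : ZMod (q i)) : ℂ := w i ^ x.val * ZMod.stdAddChar (k i * x)
    have hG (n) : G n k = ∏ i, g i (n i) := by
      simp only [G, Matrix.diagonal_mul, E, hF, fourierMatrix, g, Finset.prod_mul_distrib]
    rw [Matrix.mul_diagonal, Matrix.mul_apply]
    simp only [floquetMatrix, Pi.zero_apply, ite_self, add_zero, Finset.sum_mul]
    rw [Finset.sum_comm, blochSymbol, Finset.mul_sum]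
    refine Finset.sum_congr rfl fun j _ => ?_
    simp only [add_mul, ite_mul, zero_mul, Finset.sum_add_distrib, Finset.sum_ite_eq',
      Finset.mem_univ, if_true, mul_add]
    simp only [hG]
    congr 1
    · rw [mul_comm _ (phase q k j * w j)]
      simp only [val_eq_pred_iff, ← ite_mul]
      exact mul_prod_add_single g (mul_pow_val_add_one (w j) (k j) (n j))
    · rw [mul_comm _ (phase q k j * w j)⁻¹, sub_eq_add_neg, ← Pi.single_neg]
      simp only [ZMod.val_eq_zero, ← ite_mul]
      refine mul_prod_add_single g ?_
      rw [← sub_eq_add_neg]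
      exact mul_pow_val_sub_one (hw j) (k j) (n j)
  have hsplit : floquetMatrix q V (fun i => w i ^ q i)
      = floquetMatrix q 0 (fun i => w i ^ q i) + Matrix.diagonal V := by
    ext n n'
    simp [floquetMatrix, Matrix.diagonal_apply, eq_comm (a := n')]
  have hconj : floquetMatrix q V (fun i => w i ^ q i) * G
      = G * (Matrix.diagonal (blochSymbol (phase q) w) + F' * Matrix.diagonal V * F) := by
    rw [hsplit, Matrix.add_mul, Matrix.mul_add, hfree]
    congr 1
    simp only [G]
    rw [Matrix.mul_assoc (Matrix.diagonal E) F, ← Matrix.mul_assoc F, ← Matrix.mul_assoc F, hFF,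
      Matrix.one_mul, ← Matrix.mul_assoc, ← Matrix.mul_assoc, Matrix.diagonal_mul_diagonal,
      Matrix.diagonal_mul_diagonal]
    simp only [mul_comm]
  rw [← Matrix.mul_one (floquetMatrix q V _), ← hGG, ← Matrix.mul_assoc, hconj,
    Matrix.charpoly_mul_comm, ← Matrix.mul_assoc, mul_eq_one_comm.1 hGG, Matrix.one_mul]

lemma diag_fourier (V : (∀ i, ZMod (q i)) → ℂ) (k : ∀ i, ZMod (q i)) :
    (fourierMatrixInv q * Matrix.diagonal V * fourierMatrix q) k k
      = (∏ i, (q i : ℂ))⁻¹ * ∑ n, V n := by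
  rw [Matrix.mul_apply, Finset.mul_sum]
  refine Finset.sum_congr rfl fun n _ => ?_
  have : (∏ i, (ZMod.stdAddChar (-(k i * n i)) : ℂ)) * ∏ i, ZMod.stdAddChar (k i * n i) = 1 := by
    rw [← Finset.prod_mul_distrib]
    refine Finset.prod_eq_one fun i _ => ?_
    rw [← AddChar.map_add_eq_mul, neg_add_cancel, AddChar.map_zero_eq_one]
  rw [Matrix.mul_diagonal, fourierMatrix, fourierMatrixInv]
  linear_combination (∏ i, (q i : ℂ))⁻¹ * V n * this

/-- The characteristic polynomial of the Floquet matrix in Bloch form. -/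
lemma exists_blochDet_eq_charpoly (V : (∀ i, ZMod (q i)) → ℂ) :
    ∃ B : Matrix (∀ i, ZMod (q i)) (∀ i, ZMod (q i)) ℂ,
      B 0 0 = (∏ i, (q i : ℂ))⁻¹ * ∑ n, V n ∧ ∀ w : ι → ℂ, (∀ i, w i ≠ 0) → ∀ x,
        blochDet (phase q) B w x = (floquetMatrix q V fun i => w i ^ q i).charpoly.eval x :=
  ⟨_, diag_fourier q V 0, fun w hw x => by rw [charpoly_floquetMatrix q V hw, blochDet]⟩

end Fourier

section KroneckerSum

lemma kronecker_one_mulVec {N₁ N₂ : Type*} [Fintype N₁] [Fintype N₂] [DecidableEq N₂]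
    (M₁ : Matrix N₁ N₁ ℂ) (v : N₁ × N₂ → ℂ) (p : N₁ × N₂) :
    (Matrix.kronecker M₁ (1 : Matrix N₂ N₂ ℂ)).mulVec v p
      = M₁.mulVec (fun n => v (n, p.2)) p.1 := by
  simp [Matrix.mulVec, dotProduct, Fintype.sum_prod_type, Matrix.one_apply]

lemma one_kronecker_mulVec {N₁ N₂ : Type*} [Fintype N₁] [DecidableEq N₁] [Fintype N₂]
    (M₂ : Matrix N₂ N₂ ℂ) (v : N₁ × N₂ → ℂ) (p : N₁ × N₂) :
    (Matrix.kronecker (1 : Matrix N₁ N₁ ℂ) M₂).mulVec v p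
      = M₂.mulVec (fun m => v (p.1, m)) p.2 := by
  simp [Matrix.mulVec, dotProduct, Fintype.sum_prod_type_right, Matrix.one_apply]

variable {N N₁ N₂ : Type*} [Fintype N] [DecidableEq N] [Fintype N₁] [DecidableEq N₁] [Fintype N₂]
  [DecidableEq N₂]

lemma eval_charpoly_eq_zero_iff (M : Matrix N N ℂ) (x : ℂ) :
    M.charpoly.eval x = 0 ↔ ∃ v, v ≠ 0 ∧ M.mulVec v = x • v := by
  rw [Matrix.eval_charpoly, ← Matrix.exists_mulVec_eq_zero_iff]
  refine exists_congr fun v => and_congr_right fun _ => ?_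
  rw [Matrix.sub_mulVec, sub_eq_zero, eq_comm, Matrix.scalar_apply, ← Matrix.smul_one_eq_diagonal,
    Matrix.smul_mulVec, Matrix.one_mulVec]

lemma det_sub_smul_one_eq_zero_iff (M : Matrix N N ℂ) (x : ℂ) :
    (M - x • (1 : Matrix N N ℂ)).det = 0 ↔ M.charpoly.eval x = 0 := by
  rw [Matrix.eval_charpoly, ← neg_sub, Matrix.det_neg, Matrix.scalar_apply,
    Matrix.smul_one_eq_diagonal]
  simp

/-- The Kronecker sum `M₁ ⊗ 1 + 1 ⊗ M₂`. -/
def kroneckerSum (M₁ : Matrix N₁ N₁ ℂ) (M₂ : Matrix N₂ N₂ ℂ) : Matrix (N₁ × N₂) (N₁ × N₂) ℂ :=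
  Matrix.kronecker M₁ 1 + Matrix.kronecker 1 M₂

/-- The eigenvalues of a Kronecker sum are the sums of eigenvalues. -/
lemma eval_charpoly_kroneckerSum_eq_zero_iff (M₁ : Matrix N₁ N₁ ℂ) (M₂ : Matrix N₂ N₂ ℂ) (x : ℂ) :
    (kroneckerSum M₁ M₂).charpoly.eval x = 0 ↔
      ∃ y, M₁.charpoly.eval (x - y) = 0 ∧ M₂.charpoly.eval y = 0 := by
  simp only [eval_charpoly_eq_zero_iff]
  constructor
  · rintro ⟨v, hv, hxv⟩
    let f : Module.End ℂ (N₁ × N₂ → ℂ) := (kroneckerSum M₁ M₂).mulVecLin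
    let g : Module.End ℂ (N₁ × N₂ → ℂ) := (Matrix.kronecker M₁ (1 : Matrix N₂ N₂ ℂ)).mulVecLin
    have hfg : Commute f g := by
      change f * g = g * f
      simp only [f, g, Module.End.mul_eq_comp, ← Matrix.mulVecLin_mul]
      congr 1
      simp only [kroneckerSum, Matrix.kronecker, Matrix.add_mul, Matrix.mul_add]
      rw [← Matrix.mul_kronecker_mul, ← Matrix.mul_kronecker_mul, ← Matrix.mul_kronecker_mul]
      simp
    have hmaps : Set.MapsTo g (f.eigenspace x) (f.eigenspace x) :=
      Module.End.mapsTo_genEigenspace_of_comm hfg x 1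
    have : Nontrivial (f.eigenspace x) :=
      ⟨⟨⟨v, Module.End.mem_eigenspace_iff.2 hxv⟩, 0, fun h => hv (congrArg Subtype.val h)⟩⟩
    obtain ⟨μ, hμ⟩ := Module.End.exists_eigenvalue (g.restrict hmaps)
    obtain ⟨⟨w, hw⟩, hwμ⟩ := hμ.exists_hasEigenvector
    have hw0 : w ≠ 0 := fun h => hwμ.2 (Subtype.ext h)
    have hgw : (Matrix.kronecker M₁ (1 : Matrix N₂ N₂ ℂ)).mulVec w = μ • w :=
      congrArg Subtype.val hwμ.apply_eq_smul
    have hfw : (kroneckerSum M₁ M₂).mulVec w = x • w := Module.End.mem_eigenspace_iff.1 hw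
    have hhw : (Matrix.kronecker (1 : Matrix N₁ N₁ ℂ) M₂).mulVec w = (x - μ) • w := by
      rw [kroneckerSum, Matrix.add_mulVec, hgw] at hfw
      rw [sub_smul, ← hfw, add_sub_cancel_left]
    obtain ⟨⟨n, m⟩, hnm⟩ := Function.ne_iff.1 hw0
    refine ⟨x - μ, ⟨fun n => w (n, m), fun h => hnm (congrFun h n), ?_⟩,
      ⟨fun m => w (n, m), fun h => hnm (congrFun h m), ?_⟩⟩
    · ext n'
      have := congrFun hgw (n', m)
      rw [kronecker_one_mulVec] at this
      simpa using this
    · ext m'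
      have := congrFun hhw (n, m')
      rw [one_kronecker_mulVec] at this
      simpa using this
  · rintro ⟨y, ⟨v₁, hv₁, h₁⟩, v₂, hv₂, h₂⟩
    refine ⟨fun p => v₁ p.1 * v₂ p.2, fun h => ?_, ?_⟩
    · obtain ⟨n, hn⟩ := Function.ne_iff.1 hv₁
      obtain ⟨m, hm⟩ := Function.ne_iff.1 hv₂
      exact mul_ne_zero hn hm (congrFun h (n, m))
    · ext ⟨n, m⟩
      have e₁ : (fun n => v₁ n * v₂ m) = v₂ m • v₁ := by ext; simp [mul_comm]
      have e₂ : (fun m => v₁ n * v₂ m) = v₁ n • v₂ := by ext; simp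
      rw [kroneckerSum, Matrix.add_mulVec, Pi.add_apply, kronecker_one_mulVec,
        one_kronecker_mulVec]
      simp only [e₁, e₂, Matrix.mulVec_smul, h₁, h₂, Pi.smul_apply, smul_eq_mul]
      ring

end KroneckerSum

section Splitting

/-- Splitting the coordinates into two complementary groups. -/
def splitMap {ι ι₁ ι₂ : Type*} (q : ι → ℕ) (e₁ : ι₁ → ι) (e₂ : ι₂ → ι) (n : ∀ i, ZMod (q i)) :
    (∀ i, ZMod (q (e₁ i))) × (∀ i, ZMod (q (e₂ i))) :=
  (fun i => n (e₁ i), fun i => n (e₂ i))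

lemma splitMap_injective {ι ι₁ ι₂ : Type*} {q : ι → ℕ} {e₁ : ι₁ → ι} {e₂ : ι₂ → ι}
    (he : Function.Bijective (Sum.elim e₁ e₂)) :
    Function.Injective (splitMap q e₁ e₂) := by
  intro n n' h
  ext i
  obtain ⟨k | k, rfl⟩ := he.2 i
  · exact congrFun (congrArg Prod.fst h) k
  · exact congrFun (congrArg Prod.snd h) k

lemma single_comp_of_injective {ι κ : Type*} [DecidableEq ι] [DecidableEq κ] {q : ι → ℕ}
    {e : κ → ι}
    (he : Function.Injective e) (k k' : κ) :
    (Pi.single (e k) 1 : ∀ i, ZMod (q i)) (e k')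
      = (Pi.single k 1 : ∀ i, ZMod (q (e i))) k' := by
  by_cases h : k' = k
  · subst h
    simp
  · rw [Pi.single_eq_of_ne h, Pi.single_eq_of_ne (he.ne h)]

variable {ι ι₁ ι₂ : Type*} [Fintype ι] [DecidableEq ι] [Fintype ι₁] [DecidableEq ι₁] [Fintype ι₂]
  [DecidableEq ι₂] {q : ι → ℕ} {e₁ : ι₁ → ι} {e₂ : ι₂ → ι}

lemma splitMap_bijective [∀ i, NeZero (q i)] (he : Function.Bijective (Sum.elim e₁ e₂)) :
    Function.Bijective (splitMap q e₁ e₂) := by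
  refine (Fintype.bijective_iff_injective_and_card _).2 ⟨splitMap_injective he, ?_⟩
  rw [Fintype.card_prod, Fintype.card_pi, Fintype.card_pi, Fintype.card_pi]
  simp only [ZMod.card]
  rw [← (Equiv.ofBijective _ he).prod_comp, Fintype.prod_sum_type]
  rfl

/-- The Floquet matrix of a separable potential is a Kronecker sum. -/
lemma floquetMatrix_eq_submatrix (he : Function.Bijective (Sum.elim e₁ e₂))
    {V : (∀ i, ZMod (q i)) → ℂ} {V₁ : (∀ i, ZMod (q (e₁ i))) → ℂ}
    {V₂ : (∀ i, ZMod (q (e₂ i))) → ℂ}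
    (hV : ∀ n, V n = V₁ (fun i => n (e₁ i)) + V₂ (fun i => n (e₂ i))) (z : ι → ℂ) :
    floquetMatrix q V z = (kroneckerSum (floquetMatrix (fun i => q (e₁ i)) V₁ fun i => z (e₁ i))
      (floquetMatrix (fun i => q (e₂ i)) V₂ fun i => z (e₂ i))).submatrix
        (splitMap q e₁ e₂) (splitMap q e₁ e₂) := by
  have hinj := splitMap_injective (q := q) he
  have he₁ : Function.Injective e₁ := fun a b h => Sum.inl_injective (he.1 h)
  have he₂ : Function.Injective e₂ := fun a b h => Sum.inr_injective (he.1 h)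
  have hne (i : ι₁) (j : ι₂) : e₁ i ≠ e₂ j := fun h => by simpa using @he.1 (.inl i) (.inr j) h
  have hs₁ (k : ι₁) : splitMap q e₁ e₂ (Pi.single (e₁ k) 1) = (Pi.single k 1, 0) :=
    Prod.ext (funext fun k' => single_comp_of_injective he₁ k k')
      (funext fun k' => Pi.single_eq_of_ne (hne k k').symm _)
  have hs₂ (k : ι₂) : splitMap q e₁ e₂ (Pi.single (e₂ k) 1) = (0, Pi.single k 1) :=
    Prod.ext (funext fun k' => Pi.single_eq_of_ne (hne k' k) _)
      (funext fun k' => single_comp_of_injective he₂ k k')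
  have hadd (n n' : ∀ i, ZMod (q i)) : splitMap q e₁ e₂ (n + n')
      = splitMap q e₁ e₂ n + splitMap q e₁ e₂ n' := rfl
  have hsub (n n' : ∀ i, ZMod (q i)) : splitMap q e₁ e₂ (n - n')
      = splitMap q e₁ e₂ n - splitMap q e₁ e₂ n' := rfl
  have hp₁ (n n' : ∀ i, ZMod (q i)) (k : ι₁) : n' = n + Pi.single (e₁ k) 1 ↔
      splitMap q e₁ e₂ n' = splitMap q e₁ e₂ n + (Pi.single k 1, 0) := by
    rw [← hs₁, ← hadd, hinj.eq_iff]
  have hm₁ (n n' : ∀ i, ZMod (q i)) (k : ι₁) : n' = n - Pi.single (e₁ k) 1 ↔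
      splitMap q e₁ e₂ n' = splitMap q e₁ e₂ n - (Pi.single k 1, 0) := by
    rw [← hs₁, ← hsub, hinj.eq_iff]
  have hp₂ (n n' : ∀ i, ZMod (q i)) (k : ι₂) : n' = n + Pi.single (e₂ k) 1 ↔
      splitMap q e₁ e₂ n' = splitMap q e₁ e₂ n + (0, Pi.single k 1) := by
    rw [← hs₂, ← hadd, hinj.eq_iff]
  have hm₂ (n n' : ∀ i, ZMod (q i)) (k : ι₂) : n' = n - Pi.single (e₂ k) 1 ↔
      splitMap q e₁ e₂ n' = splitMap q e₁ e₂ n - (0, Pi.single k 1) := by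
    rw [← hs₂, ← hsub, hinj.eq_iff]
  have hn₁ (n : ∀ i, ZMod (q i)) (k : ι₁) : n (e₁ k) = (splitMap q e₁ e₂ n).1 k := rfl
  have hn₂ (n : ∀ i, ZMod (q i)) (k : ι₂) : n (e₂ k) = (splitMap q e₁ e₂ n).2 k := rfl
  ext n n'
  rw [Matrix.submatrix_apply, floquetMatrix, ← (Equiv.ofBijective _ he).sum_comp,
    Fintype.sum_sum_type, hV]
  change (∑ k : ι₁,
      ((if n' = n + Pi.single (e₁ k) 1 then
          (if (n (e₁ k)).val = q (e₁ k) - 1 then z (e₁ k) else 1) else 0)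
        + (if n' = n - Pi.single (e₁ k) 1 then
          (if (n (e₁ k)).val = 0 then (z (e₁ k))⁻¹ else 1) else 0))
    + ∑ k : ι₂,
      ((if n' = n + Pi.single (e₂ k) 1 then
          (if (n (e₂ k)).val = q (e₂ k) - 1 then z (e₂ k) else 1) else 0)
        + (if n' = n - Pi.single (e₂ k) 1 then
          (if (n (e₂ k)).val = 0 then (z (e₂ k))⁻¹ else 1) else 0)))
    + (if n' = n then V₁ (splitMap q e₁ e₂ n).1 + V₂ (splitMap q e₁ e₂ n).2 else 0) = _
  simp only [hp₁, hm₁, hp₂, hm₂, hn₁, hn₂, ← hinj.eq_iff (a := n')]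
  generalize splitMap q e₁ e₂ n = s
  generalize splitMap q e₁ e₂ n' = s'
  obtain ⟨a, b⟩ := s
  obtain ⟨a', b'⟩ := s'
  simp only [kroneckerSum, Matrix.add_apply, Matrix.kronecker, Matrix.kroneckerMap_apply,
    floquetMatrix, Prod.mk_add_mk, Prod.mk_sub_mk, add_zero, sub_zero, Prod.mk.injEq,
    Matrix.one_apply, eq_comm (a := a), eq_comm (a := b)]
  by_cases ha : a' = a <;> by_cases hb : b' = b <;> simp [ha, hb]
  ring

/-- Zeros of the Floquet determinant of a separable potential. -/
lemma det_floquetMatrix_eq_zero_iff [∀ i, NeZero (q i)]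
    (he : Function.Bijective (Sum.elim e₁ e₂))
    {V : (∀ i, ZMod (q i)) → ℂ} {V₁ : (∀ i, ZMod (q (e₁ i))) → ℂ}
    {V₂ : (∀ i, ZMod (q (e₂ i))) → ℂ}
    (hV : ∀ n, V n = V₁ (fun i => n (e₁ i)) + V₂ (fun i => n (e₂ i))) (z : ι → ℂ) (x : ℂ) :
    (floquetMatrix q V z - x • (1 : Matrix (∀ i, ZMod (q i)) (∀ i, ZMod (q i)) ℂ)).det = 0 ↔ ∃ y,
      (floquetMatrix (fun i => q (e₁ i)) V₁ fun i => z (e₁ i)).charpoly.eval (x - y) = 0 ∧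
      (floquetMatrix (fun i => q (e₂ i)) V₂ fun i => z (e₂ i)).charpoly.eval y = 0 := by
  rw [det_sub_smul_one_eq_zero_iff, floquetMatrix_eq_submatrix he hV,
    ← eval_charpoly_kroneckerSum_eq_zero_iff,
    ← Matrix.charpoly_reindex (Equiv.ofBijective _ (splitMap_bijective (q := q) he)).symm]
  rfl

end Splitting

section Mean

lemma floquetMatrix_eq_add_diagonal {ι : Type*} [Fintype ι] [DecidableEq ι] (q : ι → ℕ)
    (V : (∀ i, ZMod (q i)) → ℂ) (z : ι → ℂ) :
    floquetMatrix q V z = floquetMatrix q 0 z + Matrix.diagonal V := by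
  ext n n'
  simp [floquetMatrix, Matrix.diagonal_apply, eq_comm (a := n)]

variable {ι : Type*} [Fintype ι] [DecidableEq ι] (q : ι → ℕ) [∀ i, NeZero (q i)]

/-- The average of a potential, for coordinates indexed by an arbitrary finite type. -/
def mean (V : (∀ i, ZMod (q i)) → ℂ) : ℂ :=
  (∏ i, (q i : ℂ))⁻¹ * ∑ n, V n

lemma mean_add (V Y : (∀ i, ZMod (q i)) → ℂ) : mean q (fun n => V n + Y n)
    = mean q V + mean q Y := by
  simp only [mean, Finset.sum_add_distrib, mul_add]

lemma mean_const (c : ℂ) : mean q (fun _ => c) = c := by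
  have h : ((Fintype.card (∀ i, ZMod (q i)) : ℕ) : ℂ) = ∏ i, (q i : ℂ) := by
    rw [Fintype.card_pi]
    simp only [ZMod.card, Nat.cast_prod]
  rw [mean, Finset.sum_const, Finset.card_univ, nsmul_eq_mul, h,
    inv_mul_cancel_left₀ (prod_natCast_ne_zero q)]

lemma mean_sum {α : Type*} (s : Finset α) (V : α → (∀ i, ZMod (q i)) → ℂ) :
    mean q (fun n => ∑ a ∈ s, V a n) = ∑ a ∈ s, mean q (V a) := by
  simp only [mean, Finset.mul_sum]
  exact Finset.sum_comm

lemma eval_charpoly_floquetMatrix_add_const (V : (∀ i, ZMod (q i)) → ℂ) (z : ι → ℂ) (c x : ℂ) :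
    (floquetMatrix q (fun n => V n + c) z).charpoly.eval x
      = (floquetMatrix q V z).charpoly.eval (x - c) := by
  rw [Matrix.eval_charpoly, Matrix.eval_charpoly, floquetMatrix_eq_add_diagonal,
    floquetMatrix_eq_add_diagonal q V]
  congr 1
  have h : Matrix.diagonal (fun n => V n + c) = Matrix.diagonal V + Matrix.scalar _ c := by
    rw [Matrix.scalar_apply, Matrix.diagonal_add]
  rw [h, map_sub]
  abel

/-- The average of a potential is determined by the spectrum. -/
lemma mean_eq_of_charpoly_eq {V Y : (∀ i, ZMod (q i)) → ℂ} {z : ι → ℂ}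
    (h : (floquetMatrix q V z).charpoly = (floquetMatrix q Y z).charpoly) :
    mean q V = mean q Y := by
  have ht : (floquetMatrix q V z).trace = (floquetMatrix q Y z).trace := by
    rw [Matrix.trace_eq_neg_charpoly_coeff, Matrix.trace_eq_neg_charpoly_coeff, h]
  rw [floquetMatrix_eq_add_diagonal, floquetMatrix_eq_add_diagonal q Y, Matrix.trace_add,
    Matrix.trace_add, Matrix.trace_diagonal, Matrix.trace_diagonal] at ht
  rw [mean, mean, add_left_cancel ht]

end Mean

section TwoBlocks

lemma bijective_elim_symm {ι ι₁ ι₂ : Type*} {e₁ : ι₁ → ι} {e₂ : ι₂ → ι}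
    (he : Function.Bijective (Sum.elim e₁ e₂)) :
    Function.Bijective (Sum.elim e₂ e₁) := by
  have h : Sum.elim e₂ e₁ = Sum.elim e₁ e₂ ∘ Sum.swap := by
    ext (i | i) <;> rfl
  rw [h]
  exact he.comp (Equiv.sumComm ι₂ ι₁).bijective

lemma bijective_elim_compl {ι ι₁ : Type*} {e : ι₁ → ι} (he : Function.Injective e) :
    Function.Bijective (Sum.elim e (Subtype.val : {i // i ∉ Set.range e} → ι)) := by
  refine ⟨he.sumElim Subtype.val_injective fun a b h => b.2 ⟨a, h⟩, fun i => ?_⟩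
  by_cases h : i ∈ Set.range e
  · obtain ⟨a, rfl⟩ := h
    exact ⟨.inl a, rfl⟩
  · exact ⟨.inr ⟨i, h⟩, rfl⟩

lemma exists_pow_eq {κ : Type*} (p : κ → ℕ) [∀ i, NeZero (p i)] (z : κ → ℂ)
    (hz : ∀ i, z i ≠ 0) : ∃ w : κ → ℂ, (∀ i, w i ≠ 0) ∧ z = fun i => w i ^ p i := by
  choose w hw using fun i => IsAlgClosed.exists_pow_nat_eq (z i) (NeZero.pos (p i))
  exact ⟨w, fun i h => hz i (by rw [← hw, h, zero_pow (NeZero.ne _)]),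
    funext fun i => (hw i).symm⟩

variable {ι ι₁ ι₂ : Type*} [Fintype ι] [DecidableEq ι] [Fintype ι₁] [DecidableEq ι₁] [Fintype ι₂]
  [DecidableEq ι₂] {q : ι → ℕ} [∀ i, NeZero (q i)] {e₁ : ι₁ → ι} {e₂ : ι₂ → ι}

lemma mean_comp_left (he : Function.Bijective (Sum.elim e₁ e₂))
    (F : (∀ i, ZMod (q (e₁ i))) → ℂ) :
    mean q (fun n => F fun i => n (e₁ i)) = mean (fun i => q (e₁ i)) F := by
  have hprod : ∏ i, (q i : ℂ) = (∏ i, (q (e₁ i) : ℂ)) * ∏ i, (q (e₂ i) : ℂ) := by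
    rw [← (Equiv.ofBijective _ he).prod_comp, Fintype.prod_sum_type]
    rfl
  have hsum : ∑ n : ∀ i, ZMod (q i), F (fun i => n (e₁ i))
      = ∑ m, ∑ _m' : ∀ i, ZMod (q (e₂ i)), F m := by
    rw [← Fintype.sum_prod_type' fun m _ => F m,
      ← (Equiv.ofBijective _ (splitMap_bijective (q := q) he)).sum_comp]
    rfl
  have hc := mean_const (fun i => q (e₂ i)) (∑ m, F m)
  rw [mean] at hc
  rw [mean, mean, hsum, hprod, Finset.sum_comm, mul_inv, mul_assoc, hc]

/-- If the Fermi surface of one separable potential lies in that of another, the two parts are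
Floquet isospectral up to constants. -/
theorem charpoly_eq_of_split (he : Function.Bijective (Sum.elim e₁ e₂))
    (hcop : ∀ i i' : ι₁, i ≠ i' → Nat.Coprime (q (e₁ i)) (q (e₁ i')))
    {i₀ i₁ : ι₁} (hi : i₁ ≠ i₀) (j₀ : ι₂) {V Y : (∀ i, ZMod (q i)) → ℂ}
    {V₁ Y₁ : (∀ i, ZMod (q (e₁ i))) → ℂ} {V₂ Y₂ : (∀ i, ZMod (q (e₂ i))) → ℂ}
    (hV : ∀ n, V n = V₁ (fun i => n (e₁ i)) + V₂ (fun i => n (e₂ i)))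
    (hY : ∀ n, Y n = Y₁ (fun i => n (e₁ i)) + Y₂ (fun i => n (e₂ i))) {lam : ℂ}
    (hF : ∀ z : ι → ℂ, (∀ i, z i ≠ 0) →
      (floquetMatrix q V z - lam • (1 : Matrix (∀ i, ZMod (q i)) (∀ i, ZMod (q i)) ℂ)).det = 0 →
      (floquetMatrix q Y z - lam • (1 : Matrix (∀ i, ZMod (q i)) (∀ i, ZMod (q i)) ℂ)).det = 0) :
    mean q V = mean q Y ∧
    (∀ z, (∀ i, z i ≠ 0) → (floquetMatrix (fun i => q (e₁ i)) V₁ z).charpoly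
      = (floquetMatrix (fun i => q (e₁ i))
          (fun n => Y₁ n + (mean _ V₁ - mean _ Y₁)) z).charpoly) ∧
    (∀ z, (∀ i, z i ≠ 0) → (floquetMatrix (fun i => q (e₂ i)) V₂ z).charpoly
      = (floquetMatrix (fun i => q (e₂ i))
          (fun n => Y₂ n + (mean _ V₂ - mean _ Y₂)) z).charpoly) := by
  obtain ⟨B₁, hB₁, h₁⟩ := exists_blochDet_eq_charpoly (fun i => q (e₁ i)) V₁
  obtain ⟨B₂, hB₂, h₂⟩ := exists_blochDet_eq_charpoly (fun i => q (e₂ i)) V₂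
  obtain ⟨B₁', hB₁', h₁'⟩ := exists_blochDet_eq_charpoly (fun i => q (e₁ i)) Y₁
  obtain ⟨B₂', hB₂', h₂'⟩ := exists_blochDet_eq_charpoly (fun i => q (e₂ i)) Y₂
  have hshift := blochDet_shift_of_coprime (q₁ := fun i => q (e₁ i)) (q₂ := fun i => q (e₂ i))
    hcop hi j₀ (B₁ := B₁) (B₁' := B₁') (B₂ := B₂) (B₂' := B₂') (lam := lam)
    (c := mean _ V₁ - mean _ Y₁) ?_ (by rw [hB₁, hB₁', mean, mean])
  · obtain ⟨hs₁, hs₂⟩ := hshift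
    have hc₁ (z) (hz : ∀ i, z i ≠ 0) : (floquetMatrix (fun i => q (e₁ i)) V₁ z).charpoly
        = (floquetMatrix (fun i => q (e₁ i))
          (fun n => Y₁ n + (mean _ V₁ - mean _ Y₁)) z).charpoly := by
      obtain ⟨w, hw, rfl⟩ := exists_pow_eq (fun i => q (e₁ i)) z hz
      refine Polynomial.funext fun x => ?_
      rw [eval_charpoly_floquetMatrix_add_const, ← h₁ w hw, ← h₁' w hw, hs₁ w hw]
    have hc₂ (z) (hz : ∀ i, z i ≠ 0) : (floquetMatrix (fun i => q (e₂ i)) V₂ z).charpoly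
        = (floquetMatrix (fun i => q (e₂ i))
          (fun n => Y₂ n + -(mean _ V₁ - mean _ Y₁)) z).charpoly := by
      obtain ⟨w, hw, rfl⟩ := exists_pow_eq (fun i => q (e₂ i)) z hz
      refine Polynomial.funext fun x => ?_
      rw [eval_charpoly_floquetMatrix_add_const, ← h₂ w hw, ← h₂' w hw, hs₂ w hw, sub_neg_eq_add]
    have hm := mean_eq_of_charpoly_eq _ (hc₂ (fun _ => 1) fun _ => one_ne_zero)
    rw [mean_add, mean_const] at hm
    have hm' : mean (fun i => q (e₂ i)) V₂ - mean _ Y₂ = -(mean _ V₁ - mean _ Y₁) := by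
      rw [hm]
      ring
    refine ⟨?_, hc₁, by rwa [hm']⟩
    rw [funext hV, funext hY, mean_add, mean_add, mean_comp_left he, mean_comp_left he,
      mean_comp_left (bijective_elim_symm he), mean_comp_left (bijective_elim_symm he)]
    linear_combination hm
  · intro u v hu hv x hx₁ hx₂
    let z : ι → ℂ := fun i => Sum.elim (fun i => u i ^ q (e₁ i)) (fun i => v i ^ q (e₂ i))
      ((Equiv.ofBijective _ he).symm i)
    have hz₁ : (fun i => z (e₁ i)) = fun i => u i ^ q (e₁ i) := by
      ext i
      have := (Equiv.ofBijective _ he).symm_apply_apply (.inl i)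
      simp only [z]
      exact congrArg (Sum.elim _ _) this
    have hz₂ : (fun i => z (e₂ i)) = fun i => v i ^ q (e₂ i) := by
      ext i
      have := (Equiv.ofBijective _ he).symm_apply_apply (.inr i)
      simp only [z]
      exact congrArg (Sum.elim _ _) this
    have hz (i) : z i ≠ 0 := by
      simp only [z]
      rcases (Equiv.ofBijective _ he).symm i with k | k
      · exact pow_ne_zero _ (hu k)
      · exact pow_ne_zero _ (hv k)
    have h := hF z hz
    rw [det_floquetMatrix_eq_zero_iff he hV, det_floquetMatrix_eq_zero_iff he hY, hz₁, hz₂] at h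
    obtain ⟨y, hy₁, hy₂⟩ := h ⟨x, by rw [← h₁ u hu, hx₁], by rw [← h₂ v hv, hx₂]⟩
    exact ⟨y, by rw [h₁' u hu, hy₁], by rw [h₂' v hv, hy₂]⟩

end TwoBlocks

section Blocks

variable {d r : ℕ} {ds : Fin r → ℕ} {hsum : ∑ m, ds m = d}

lemma blockEmb_injective (j : Fin r) : Function.Injective (blockEmb ds hsum j) := by
  intro b b' h
  have := congrArg Fin.val h
  simp only [blockEmb] at this
  exact Fin.ext (by omega)

lemma blockOffset_add_le_of_lt {j j' : Fin r} (h : j < j') :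
    blockOffset ds j + ds j ≤ blockOffset ds j' := by
  have hj : j ∉ Finset.univ.filter (fun m : Fin r => m < j) := by simp
  have hins : blockOffset ds j + ds j
      = ∑ m ∈ insert j (Finset.univ.filter (fun m : Fin r => m < j)), ds m := by
    rw [Finset.sum_insert hj, Nat.add_comm, blockOffset]
  rw [hins]
  refine Finset.sum_le_sum_of_subset fun m hm => ?_
  rcases Finset.mem_insert.1 hm with rfl | hm
  · simpa using h
  · simpa using (Finset.mem_filter.1 hm).2.trans h

lemma blockEmb_ne {j j' : Fin r} (h : j ≠ j') (b : Fin (ds j)) (b' : Fin (ds j')) :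
    blockEmb ds hsum j b ≠ blockEmb ds hsum j' b' := by
  intro hb
  have hv := congrArg Fin.val hb
  simp only [blockEmb] at hv
  have := b.isLt
  have := b'.isLt
  rcases lt_or_gt_of_ne h with h | h
  · have := blockOffset_add_le_of_lt (ds := ds) h
    omega
  · have := blockOffset_add_le_of_lt (ds := ds) h
    omega

/-- Extension by zero of coordinates outside the `j`-th block. -/
def extendZero (q : Fin d → ℕ) (j : Fin r)
    (m : ∀ i : {i // i ∉ Set.range (blockEmb ds hsum j)}, ZMod (q i)) (i : Fin d) : ZMod (q i) :=
  open Classical in if h : i ∉ Set.range (blockEmb ds hsum j) then m ⟨i, h⟩ else 0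

/-- The part of a separable potential that does not involve the `j`-th block. -/
def complPotential (q : Fin d → ℕ) (j : Fin r)
    (Vj : ∀ j : Fin r, ((∀ b : Fin (ds j), ZMod (q (blockEmb ds hsum j b))) → ℂ))
    (m : ∀ i : {i // i ∉ Set.range (blockEmb ds hsum j)}, ZMod (q i)) : ℂ :=
  ∑ j' ∈ Finset.univ.erase j, Vj j' fun b => extendZero q j m (blockEmb ds hsum j' b)

lemma sum_eq_add_complPotential (q : Fin d → ℕ) (j : Fin r)
    (Vj : ∀ j : Fin r, ((∀ b : Fin (ds j), ZMod (q (blockEmb ds hsum j b))) → ℂ))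
    (n : ∀ i, ZMod (q i)) :
    ∑ j, Vj j (fun b => n (blockEmb ds hsum j b))
      = Vj j (fun b => n (blockEmb ds hsum j b)) + complPotential q j Vj (fun i => n i) := by
  rw [← Finset.add_sum_erase _ _ (Finset.mem_univ j), complPotential]
  congr 1
  refine Finset.sum_congr rfl fun j' hj' => congrArg _ (funext fun b => ?_)
  have hb : blockEmb ds hsum j' b ∉ Set.range (blockEmb ds hsum j) := by
    rintro ⟨b', hb'⟩
    exact blockEmb_ne (Finset.ne_of_mem_erase hj').symm b' b hb'
  rw [extendZero, dif_pos hb]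

end Blocks

end Auxiliary

/-- For `d ≥ 3` and pairwise coprime periods, if complex-valued separable
potentials `V = ⊕ Vⱼ` and `Y = ⊕ Yⱼ` are Fermi isospectral, then up to constants summing to
zero, `Vⱼ` and `Yⱼ + cⱼ` are Floquet isospectral. -/
theorem stmt12 {d r : ℕ} (hd : 3 ≤ d) (hr : 2 ≤ r)
    (q : Fin d → ℕ) [∀ i, NeZero (q i)]
    (hcop : ∀ i i' : Fin d, i ≠ i' → Nat.Coprime (q i) (q i'))
    (ds : Fin r → ℕ) (hds : ∀ j, 1 ≤ ds j) (hsum : ∑ m, ds m = d)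
    (V Y : (∀ i, ZMod (q i)) → ℂ)
    (Vj : ∀ j : Fin r, ((∀ b : Fin (ds j), ZMod (q (blockEmb ds hsum j b))) → ℂ))
    (Yj : ∀ j : Fin r, ((∀ b : Fin (ds j), ZMod (q (blockEmb ds hsum j b))) → ℂ))
    (hV : ∀ n, V n = ∑ j, Vj j (fun b => n (blockEmb ds hsum j b)))
    (hY : ∀ n, Y n = ∑ j, Yj j (fun b => n (blockEmb ds hsum j b)))
    (hiso : FermiIso q V Y) :
    ∃ c : Fin r → ℂ, (∑ j, c j) = 0 ∧
      ∀ j : Fin r, FloquetIso (fun b => q (blockEmb ds hsum j b)) (Vj j)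
        (fun m => Yj j m + c j) := by
  classical
  obtain ⟨lam, hlam⟩ := hiso
  have hF (z : Fin d → ℂ) (hz : ∀ i, z i ≠ 0)
      (h : (floquetMatrix q V z
        - lam • (1 : Matrix (∀ i, ZMod (q i)) (∀ i, ZMod (q i)) ℂ)).det = 0) :
      (floquetMatrix q Y z
        - lam • (1 : Matrix (∀ i, ZMod (q i)) (∀ i, ZMod (q i)) ℂ)).det = 0 :=
    (hlam.subset ⟨hz, h⟩ : _ ∧ _).2
  have key (j : Fin r) : mean q V = mean q Y ∧ ∀ z, (∀ i, z i ≠ 0) →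
      (floquetMatrix (fun b => q (blockEmb ds hsum j b)) (Vj j) z).charpoly
        = (floquetMatrix (fun b => q (blockEmb ds hsum j b))
          (fun n => Yj j n + (mean _ (Vj j) - mean _ (Yj j))) z).charpoly := by
    have hinj := blockEmb_injective (hsum := hsum) j
    have he := bijective_elim_compl hinj
    have hV' (n) := (hV n).trans (sum_eq_add_complPotential q j Vj n)
    have hY' (n) := (hY n).trans (sum_eq_add_complPotential q j Yj n)
    have hcard := Fintype.card_congr (Equiv.ofBijective _ he)
    rw [Fintype.card_sum, Fintype.card_fin, Fintype.card_fin] at hcard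
    by_cases hj : 2 ≤ ds j
    · obtain ⟨j', hj'⟩ : ∃ j', j' ≠ j :=
        have := Fin.nontrivial_iff_two_le.2 hr
        exists_ne j
      have hne : blockEmb ds hsum j' ⟨0, hds j'⟩ ∉ Set.range (blockEmb ds hsum j) :=
        fun ⟨b, hb⟩ => blockEmb_ne hj'.symm b _ hb
      obtain ⟨h, h₁, -⟩ := charpoly_eq_of_split he (fun i i' h => hcop _ _ (hinj.ne h))
        (i₀ := ⟨0, by omega⟩) (i₁ := ⟨1, hj⟩) (by simp) ⟨_, hne⟩ hV' hY' hF
      exact ⟨h, h₁⟩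
    · obtain ⟨i₀, i₁, hi⟩ :=
        Fintype.one_lt_card_iff.1 (show 1 < Fintype.card {i // i ∉ Set.range (blockEmb ds hsum j)}
          by omega)
      obtain ⟨h, -, h₁⟩ := charpoly_eq_of_split (bijective_elim_symm he)
        (fun i i' h => hcop _ _ (Subtype.val_injective.ne h)) hi.symm ⟨0, hds j⟩
        (fun n => (hV' n).trans (add_comm _ _)) (fun n => (hY' n).trans (add_comm _ _)) hF
      exact ⟨h, h₁⟩
  have hmean (F : ∀ j : Fin r, ((∀ b : Fin (ds j), ZMod (q (blockEmb ds hsum j b))) → ℂ)) :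
      mean q (fun n => ∑ j, F j (fun b => n (blockEmb ds hsum j b))) = ∑ j, mean _ (F j) := by
    rw [mean_sum]
    exact Finset.sum_congr rfl fun j _ =>
      mean_comp_left (bijective_elim_compl (blockEmb_injective j)) (F j)
  refine ⟨fun j => mean _ (Vj j) - mean _ (Yj j), ?_,
    fun j k => (key j).2 _ fun _ => Complex.exp_ne_zero _⟩
  rw [Finset.sum_sub_distrib, ← hmean, ← hmean, ← funext hV, ← funext hY,
    (key ⟨0, by omega⟩).1, sub_self]

end DPSO
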